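/- Let q be a prime power and G = SL₃(q) ⋊ ⟨t⟩, where t acts on SL₃(q) as the transpose–inverse automorphism. Assume (i) 6 divides q−1; (ii) there exist λ, μ ∈ GF(q) with 2λ² = 1 and 2μ² − λ² = 0; and (iii) at least one of −3⁻¹ + (3⁻² − 1)^{1/2} and −3⁻¹ − (3⁻² − 1)^{1/2} (square roots taken in GF(q²)) has multiplicative order q+1 in GF(q²)ˣ. Then G possesses an unravelled rank 4 C-string with Schläfli symbol [4, q+1, 4]. -/

import Mathlib

open Matrix

/-- A C-string of rank `n` for a group `G`: a family of involutions generating `G`,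
with non-adjacent members commuting, satisfying the intersection property. -/
def IsCString {G : Type*} [Group G] {n : ℕ} (t : Fin n → G) : Prop :=
  (∀ i, orderOf (t i) = 2) ∧
  Subgroup.closure (Set.range t) = ⊤ ∧
  (∀ i j : Fin n, 2 ≤ ((i : ℤ) - (j : ℤ)).natAbs → Commute (t i) (t j)) ∧
  ∀ J K : Set (Fin n),
    Subgroup.closure (t '' J) ⊓ Subgroup.closure (t '' K) = Subgroup.closure (t '' (J ∩ K))

/-- A C-string is unravelled if, modulo every nontrivial proper normal subgroup,
either its members do not stay distinct or they no longer form a C-string. -/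
def IsUnravelled {G : Type*} [Group G] {n : ℕ} (t : Fin n → G) : Prop :=
  ∀ (N : Subgroup G) [N.Normal], N ≠ ⊥ → N ≠ ⊤ →
    ¬ Function.Injective (fun i => (QuotientGroup.mk (t i) : G ⧸ N)) ∨
    ¬ IsCString (fun i => (QuotientGroup.mk (t i) : G ⧸ N))

local notation "SL3" => Matrix.SpecialLinearGroup (Fin 3)

/-- The data of `SL₃(F) ⋊ ⟨τ⟩`, where `τ` acts as the transpose-inverse automorphism. -/
structure IsTransposeInverseExtension {F G : Type*} [Field F] [Group G]
    (ι : Matrix.SpecialLinearGroup (Fin 3) F →* G) (τ : G) : Prop where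
  injective : Function.Injective ι
  mul_self : τ * τ = 1
  conj : ∀ A, τ * ι A = ι A⁻¹.transpose * τ
  cover : ∀ g, ∃ A, g = ι A ∨ g = ι A * τ
  outer : ∀ A, ι A ≠ τ

namespace IsTransposeInverseExtension

variable {F G : Type*} [Field F] [Group G] {ι : SL3 F →* G} {τ : G}

lemma inner_ne_outer (hE : IsTransposeInverseExtension ι τ) (A B : SL3 F) :
    ι A ≠ ι B * τ := by
  intro h
  refine hE.outer (B⁻¹ * A) ?_
  rw [map_mul, map_inv, h, inv_mul_cancel_left]

lemma inv_transpose_mul_transpose (A : SL3 F) : A⁻¹.transpose * A.transpose = 1 := by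
  apply Subtype.ext
  rw [Matrix.SpecialLinearGroup.coe_mul, Matrix.SpecialLinearGroup.coe_transpose,
    Matrix.SpecialLinearGroup.coe_transpose, ← Matrix.transpose_mul,
    ← Matrix.SpecialLinearGroup.coe_mul, mul_inv_cancel, Matrix.SpecialLinearGroup.coe_one,
    Matrix.transpose_one]

lemma inv_transpose (A : SL3 F) : A⁻¹.transpose = (A.transpose)⁻¹ :=
  eq_inv_of_mul_eq_one_left (inv_transpose_mul_transpose A)

lemma outer_mul_outer (hE : IsTransposeInverseExtension ι τ) (A B : SL3 F) :
    ι A * τ * (ι B * τ) = ι (A * (B.transpose)⁻¹) := by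
  rw [mul_assoc, ← mul_assoc τ, hE.conj, mul_assoc (ι _) τ τ, hE.mul_self, mul_one, map_mul,
    inv_transpose]

lemma outer_mul_inner (hE : IsTransposeInverseExtension ι τ) (A B : SL3 F) :
    ι A * τ * ι B = ι (A * (B.transpose)⁻¹) * τ := by
  rw [mul_assoc, hE.conj, ← mul_assoc, map_mul, inv_transpose]

lemma outer_mul_outer_eq (hE : IsTransposeInverseExtension ι τ) {A B C : SL3 F}
    (h : A = C * B.transpose) : ι A * τ * (ι B * τ) = ι C := by
  rw [hE.outer_mul_outer, h, mul_inv_cancel_right]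

lemma outer_mul_inner_eq (hE : IsTransposeInverseExtension ι τ) {A B C : SL3 F}
    (h : A = C * B.transpose) : ι A * τ * ι B = ι C * τ := by
  rw [hE.outer_mul_inner, h, mul_inv_cancel_right]

lemma outer_mul_self (hE : IsTransposeInverseExtension ι τ) {S : SL3 F}
    (h : S = S.transpose) : ι S * τ * (ι S * τ) = 1 := by
  rw [hE.outer_mul_outer_eq (C := 1) (by rwa [one_mul]), map_one]

lemma commute_iff (hE : IsTransposeInverseExtension ι τ) (A S : SL3 F) :
    Commute (ι A) (ι S * τ) ↔ A * S * A.transpose = S := by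
  rw [commute_iff_eq, outer_mul_inner hE, ← mul_assoc, ← map_mul, mul_left_inj,
    hE.injective.eq_iff, eq_mul_inv_iff_mul_eq]

lemma outer_commute_outer (hE : IsTransposeInverseExtension ι τ) {A B C : SL3 F}
    (h : A = C * B.transpose) (h' : B = C * A.transpose) :
    Commute (ι A * τ) (ι B * τ) := by
  rw [commute_iff_eq, hE.outer_mul_outer_eq h, hE.outer_mul_outer_eq h']

end IsTransposeInverseExtension

section normal

variable {F : Type*} [Field F]

/-- The matrix `1 + a φᵀ`. -/
def elation (a φ : Fin 3 → F) : Matrix (Fin 3) (Fin 3) F := 1 + vecMulVec a φ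

lemma elation_mul_elation (a b φ ψ : Fin 3 → F) :
    elation a φ * elation b ψ =
      1 + vecMulVec a φ + vecMulVec b ψ + (φ ⬝ᵥ b) • vecMulVec a ψ := by
  simp only [elation, mul_add, add_mul, vecMulVec_mul_vecMulVec, vecMulVec_smul, one_mul, mul_one]
  abel

lemma elation_mul_elation_left {a b φ : Fin 3 → F} (h : φ ⬝ᵥ b = 0) :
    elation a φ * elation b φ = elation (a + b) φ := by
  rw [elation_mul_elation, h, zero_smul, elation, add_vecMulVec]
  abel

lemma elation_mul_elation_right {a φ ψ : Fin 3 → F} (h : φ ⬝ᵥ a = 0) :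
    elation a φ * elation a ψ = elation a (φ + ψ) := by
  rw [elation_mul_elation, h, zero_smul, elation, vecMulVec_add]
  abel

lemma elation_mul_neg {a φ : Fin 3 → F} (h : φ ⬝ᵥ a = 0) :
    elation a φ * elation (-a) φ = 1 := by
  rw [elation_mul_elation_left (by simp [h])]
  simp [elation]

lemma mul_elation_mul {A B : Matrix (Fin 3) (Fin 3) F} (h : A * B = 1) (a φ : Fin 3 → F) :
    A * elation a φ * B = elation (A *ᵥ a) (φ ᵥ* B) := by
  rw [elation, mul_add, add_mul, mul_one, h, mul_vecMulVec, vecMulVec_mul, elation]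

lemma elation_conj {v ψ : Fin 3 → F} (h : ψ ⬝ᵥ v = 0) (a φ : Fin 3 → F) :
    elation v ψ * elation a φ * elation (-v) ψ =
      elation (a + (ψ ⬝ᵥ a) • v) (φ - (φ ⬝ᵥ v) • ψ) := by
  rw [mul_elation_mul (elation_mul_neg h)]
  congr 1
  · simp [elation, add_mulVec, vecMulVec_mulVec]
  · simp [elation, vecMul_add, vecMul_vecMulVec, sub_eq_add_neg, neg_vecMulVec, vecMul_neg]

lemma det_elation {a φ : Fin 3 → F} (h : φ ⬝ᵥ a = 0) : (elation a φ).det = 1 := by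
  rw [elation, vecMulVec_eq Unit, det_one_add_replicateCol_mul_replicateRow, h, add_zero]

/-- The matrices underlying the elements of a subgroup of `SL₃(F)`. -/
def Subgroup.matrices (Y : Subgroup (SL3 F)) : Submonoid (Matrix (Fin 3) (Fin 3) F) :=
  Y.toSubmonoid.map Matrix.SpecialLinearGroup.coeMonoidHom

variable {Y : Subgroup (SL3 F)}

lemma coe_mem_matrices {A : SL3 F} : (A : Matrix (Fin 3) (Fin 3) F) ∈ Y.matrices ↔ A ∈ Y := by
  constructor
  · rintro ⟨B, hB, h⟩
    rwa [← show B = A from Subtype.ext h]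
  · exact fun h => ⟨A, h, rfl⟩

lemma mem_matrices_of_mul_eq_one {M N : Matrix (Fin 3) (Fin 3) F} (hM : M ∈ Y.matrices)
    (h : M * N = 1) : N ∈ Y.matrices := by
  obtain ⟨A, hA, rfl⟩ := hM
  have : N = (A⁻¹ : SL3 F) := by
    have h1 : ((A⁻¹ : SL3 F) : Matrix (Fin 3) (Fin 3) F) * A = 1 := by
      rw [← Matrix.SpecialLinearGroup.coe_mul, inv_mul_cancel, Matrix.SpecialLinearGroup.coe_one]
    exact (left_inv_eq_right_inv h1 h).symm
  rw [this]
  exact coe_mem_matrices.2 (inv_mem hA)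

lemma mem_matrices_of_mul_eq_one' {M N : Matrix (Fin 3) (Fin 3) F} (hM : M ∈ Y.matrices)
    (h : N * M = 1) : N ∈ Y.matrices :=
  mem_matrices_of_mul_eq_one hM (mul_eq_one_comm.1 h)

lemma conj_mem_matrices [hY : Y.Normal] {M A B : Matrix (Fin 3) (Fin 3) F} (hM : M ∈ Y.matrices)
    (hA : A.det = 1) (hAB : A * B = 1) : A * M * B ∈ Y.matrices := by
  obtain ⟨N, hN, rfl⟩ := hM
  have hB : B = ((⟨A, hA⟩ : SL3 F)⁻¹ : SL3 F) := by
    refine (left_inv_eq_right_inv (a := A) ?_ hAB).symm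
    exact congrArg Subtype.val (inv_mul_cancel (G := SL3 F) ⟨A, hA⟩)
  rw [hB]
  exact coe_mem_matrices.2 (hY.conj_mem N hN ⟨A, hA⟩)

lemma transvection_eq_elation (i j : Fin 3) (k : F) :
    Matrix.transvection i j k = elation (Pi.single i k) (Pi.single j 1) := by
  ext a b
  simp [Matrix.transvection, elation, vecMulVec_apply, Matrix.single_apply, Pi.single_apply]
  grind

lemma eq_top_of_forall_elation_mem
    (h : ∀ i j : Fin 3, i ≠ j → ∀ k, elation (Pi.single i k) (Pi.single j 1) ∈ Y.matrices) :
    Y = ⊤ := by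
  have htr (i j : Fin 3) (hij : i ≠ j) (k : F) : SpecialLinearGroup.transvection hij k ∈ Y := by
    rw [← coe_mem_matrices]
    change Matrix.transvection i j k ∈ Y.matrices
    rw [transvection_eq_elation]
    exact h i j hij k
  refine eq_top_iff.2 fun M _ =>
    Matrix.SpecialLinearGroup.diagonal_transvection_induction' (· ∈ Y) M ?_ htr
      fun _ _ => mul_mem
  intro i j hij c hc
  have hmat : (diagonal fun k => if k = i then c else if k = j then c⁻¹ else 1) =
      (1 + single i j c) * (1 + single j i (-c⁻¹)) * (1 + single i j c) * (1 + single i j (-1)) *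
        (1 + single j i 1) * (1 + single i j (-1)) := by
    simp only [mul_add, add_mul, mul_one, one_mul, single_mul_single_same,
      single_mul_single_of_ne _ _ _ _ hij, single_mul_single_of_ne _ _ _ _ hij.symm,
      add_zero]
    ext a b
    simp only [diagonal_apply, Matrix.add_apply, Matrix.one_apply, single_apply]
    grind
  have : Matrix.SpecialLinearGroup.diag2n hij c hc =
      SpecialLinearGroup.transvection hij c * SpecialLinearGroup.transvection hij.symm (-c⁻¹) *
      SpecialLinearGroup.transvection hij c * SpecialLinearGroup.transvection hij (-1) *
      SpecialLinearGroup.transvection hij.symm 1 * SpecialLinearGroup.transvection hij (-1) :=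
    Subtype.ext hmat
  rw [this]
  exact mul_mem (mul_mem (mul_mem (mul_mem (mul_mem (htr _ _ _ _) (htr _ _ _ _)) (htr _ _ _ _))
    (htr _ _ _ _)) (htr _ _ _ _)) (htr _ _ _ _)

end normal

section normal

variable {F : Type*} [Field F] {Y : Subgroup (SL3 F)}

lemma exists_third (i j : Fin 3) : ∃ l, i ≠ l ∧ j ≠ l := by
  revert i j
  decide

lemma eq_or_eq_or_eq_of_ne {i j l : Fin 3} (hij : i ≠ j) (hil : i ≠ l) (hjl : j ≠ l)
    (x : Fin 3) : x = i ∨ x = j ∨ x = l := by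
  revert i j l x
  decide

lemma elation_mem_of_commutator_right [Y.Normal] {a v φ ψ : Fin 3 → F}
    (h : elation a φ ∈ Y.matrices) (ha : φ ⬝ᵥ a = 0) (hψa : ψ ⬝ᵥ a = 0) (hψv : ψ ⬝ᵥ v = 0) :
    elation a ((φ ⬝ᵥ v) • ψ) ∈ Y.matrices := by
  have h1 := conj_mem_matrices h (det_elation hψv) (elation_mul_neg hψv)
  rw [elation_conj hψv, hψa, zero_smul, add_zero] at h1
  have h2 := mem_matrices_of_mul_eq_one' (N := elation a ((φ ⬝ᵥ v) • ψ - φ)) h1 (by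
    rw [elation_mul_elation_right (by simp [sub_dotProduct, ha, hψa])]
    simp [elation])
  have h3 := mul_mem h2 h
  rwa [elation_mul_elation_right (by simp [sub_dotProduct, ha, hψa]), sub_add_cancel] at h3

lemma elation_mem_of_commutator_left [Y.Normal] {a v φ ψ : Fin 3 → F}
    (h : elation a φ ∈ Y.matrices) (ha : φ ⬝ᵥ a = 0) (hφv : φ ⬝ᵥ v = 0) (hψv : ψ ⬝ᵥ v = 0) :
    elation ((ψ ⬝ᵥ a) • v) φ ∈ Y.matrices := by
  have h1 := conj_mem_matrices h (det_elation hψv) (elation_mul_neg hψv)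
  rw [elation_conj hψv, hφv, zero_smul, sub_zero] at h1
  have h2 := mem_matrices_of_mul_eq_one h (elation_mul_neg ha)
  have h3 := mul_mem h1 h2
  rwa [elation_mul_elation_left (by simp [ha]), add_neg_cancel_comm] at h3

lemma elation_congr {a φ b ψ : Fin 3 → F} (h : ∀ i j, a i * φ j = b i * ψ j) :
    elation a φ = elation b ψ := by
  rw [elation, elation, show vecMulVec a φ = vecMulVec b ψ from Matrix.ext h]

lemma eq_top_of_elation_single_mem [Y.Normal] {i j : Fin 3} (hij : i ≠ j) {c : F} (hc : c ≠ 0)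
    (h : elation (Pi.single i c) (Pi.single j 1) ∈ Y.matrices) : Y = ⊤ := by
  have right {i j l : Fin 3} (hij : i ≠ j) (hil : i ≠ l) (hjl : j ≠ l) {c : F} (hc : c ≠ 0)
      (h : elation (Pi.single i c) (Pi.single j 1) ∈ Y.matrices) (k : F) :
      elation (Pi.single i k) (Pi.single l 1) ∈ Y.matrices := by
    have := elation_mem_of_commutator_right (v := Pi.single j 1) (ψ := Pi.single l (k / c)) h
      (by simp [hij]) (by simp [hil]) (by simp [hjl])
    convert this using 1
    refine elation_congr fun a b => ?_
    simp only [Pi.single_apply, Pi.smul_apply, dotProduct_single_one, smul_eq_mul]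
    grind
  have left {i j l : Fin 3} (hij : i ≠ j) (hil : i ≠ l) (hjl : j ≠ l) {c : F} (hc : c ≠ 0)
      (h : elation (Pi.single i c) (Pi.single j 1) ∈ Y.matrices) (k : F) :
      elation (Pi.single l k) (Pi.single j 1) ∈ Y.matrices := by
    have := elation_mem_of_commutator_left (v := Pi.single l (k / c)) (ψ := Pi.single i 1) h
      (by simp [hij]) (by simp [hjl]) (by simp [hil])
    convert this using 1
    refine elation_congr fun a b => ?_
    simp only [Pi.single_apply, Pi.smul_apply, single_one_dotProduct, smul_eq_mul]
    grind
  obtain ⟨l, hil, hjl⟩ := exists_third i j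
  have il := right hij hil hjl hc h
  have lj := left hij hil hjl hc h
  have ij := right hil hij hjl.symm one_ne_zero (il 1)
  have jl := left hil hij hjl.symm one_ne_zero (il 1)
  have ji := right hjl hij.symm hil.symm one_ne_zero (jl 1)
  have li := right hjl.symm hil.symm hij.symm one_ne_zero (lj 1)
  refine eq_top_of_forall_elation_mem fun x y hxy k => ?_
  obtain rfl | rfl | rfl := eq_or_eq_or_eq_of_ne hij hil hjl x <;>
    obtain rfl | rfl | rfl := eq_or_eq_or_eq_of_ne hij hil hjl y <;>
    first
      | exact absurd rfl hxy
      | exact ij k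
      | exact il k
      | exact jl k
      | exact ji k
      | exact li k
      | exact lj k

lemma eq_top_of_elation_mem_of_apply_eq_zero [Y.Normal] {a φ : Fin 3 → F} (ha : a ≠ 0)
    (hφ : φ ≠ 0) (hφa : φ ⬝ᵥ a = 0) {p : Fin 3} (hp : φ p = 0)
    (h : elation a φ ∈ Y.matrices) : Y = ⊤ := by
  obtain ⟨c, hc, hcp⟩ : ∃ c : F, c ≠ 0 ∧ elation (Pi.single p c) φ ∈ Y.matrices := by
    by_cases hi : ∃ i, i ≠ p ∧ a i ≠ 0
    · obtain ⟨i, hip, hi⟩ := hi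
      refine ⟨a i, hi, ?_⟩
      have := elation_mem_of_commutator_left (v := Pi.single p 1) (ψ := Pi.single i 1) h hφa
        (by simp [hp]) (by simp [hip])
      convert this using 2
      simp [← Pi.single_smul]
    · have hap : a = Pi.single p (a p) := by
        ext i
        by_cases hip : i = p
        · simp [hip]
        · simp only [ne_eq, not_exists, not_and, not_not] at hi
          simp [hip, hi i hip]
      refine ⟨a p, fun h0 => ha (by rw [hap, h0, Pi.single_zero]), hap ▸ h⟩
  obtain ⟨k, hk⟩ := Function.ne_iff.1 hφ
  have hkp : k ≠ p := by
    rintro rfl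
    exact hk hp
  obtain ⟨l, hkl, hpl⟩ := exists_third k p
  have := elation_mem_of_commutator_right (v := Pi.single k 1) (ψ := Pi.single l 1) hcp
    (by simp [hp]) (by simp [hpl]) (by simp [hkl])
  refine eq_top_of_elation_single_mem hpl (c := φ k * c) (mul_ne_zero hk hc) ?_
  convert this using 1
  refine elation_congr fun a b => ?_
  simp only [Pi.single_apply, Pi.smul_apply, dotProduct_single_one, smul_eq_mul]
  grind

lemma eq_top_of_elation_mem [Y.Normal] {a φ : Fin 3 → F} (ha : a ≠ 0) (hφ : φ ≠ 0)
    (hφa : φ ⬝ᵥ a = 0) (h : elation a φ ∈ Y.matrices) : Y = ⊤ := by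
  by_cases h2 : φ 2 = 0
  · exact eq_top_of_elation_mem_of_apply_eq_zero ha hφ hφa h2 h
  have := elation_mem_of_commutator_right (v := Pi.single 2 1) (ψ := ![a 1, -a 0, 0]) h hφa
    (by simp [dotProduct, Fin.sum_univ_three]; ring) (by simp)
  refine eq_top_of_elation_mem_of_apply_eq_zero (p := 2) ha ?_ ?_ (by simp) this
  · intro h0
    have h0' : (![a 1, -a 0, 0] : Fin 3 → F) = 0 := by simpa [h2] using h0
    have a1 : a 1 = 0 := congrFun h0' 0
    have a0 : a 0 = 0 := by simpa using congrFun h0' 1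
    have a2 : a 2 = 0 := by simpa [dotProduct, Fin.sum_univ_three, a1, a0, h2] using hφa
    exact ha (by ext i; fin_cases i <;> assumption)
  · simp [dotProduct, Fin.sum_univ_three]
    ring

end normal

section normal

variable {F : Type*} [Field F] {Y : Subgroup (SL3 F)}

lemma mem_center_of_cross_mulVec_eq_zero {A : SL3 F}
    (h : ∀ v : Fin 3 → F, crossProduct v ((A : Matrix (Fin 3) (Fin 3) F) *ᵥ v) = 0) :
    A ∈ Subgroup.center (SL3 F) := by
  obtain ⟨A, hA⟩ := A
  change ∀ v : Fin 3 → F, crossProduct v (A *ᵥ v) = 0 at h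
  have h0 := h ![1, 0, 0]
  have h1 := h ![0, 1, 0]
  have h2 := h ![0, 0, 1]
  have h01 := h ![1, 1, 0]
  have h02 := h ![1, 0, 1]
  simp [funext_iff, Fin.forall_fin_succ, cross_apply, mulVec, dotProduct, Fin.sum_univ_three]
    at h0 h1 h2 h01 h02
  have hs : scalar (Fin 3) (A 0 0) = A := by
    ext i j
    fin_cases i <;> fin_cases j <;> simp <;> grind
  refine Matrix.SpecialLinearGroup.mem_center_iff.2 ⟨A 0 0, ?_, hs⟩
  have : (scalar (Fin 3) (A 0 0)).det = 1 := by rw [hs, hA]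
  simpa using this

lemma eq_smul_of_dotProduct_eq_zero {v w χ : Fin 3 → F} (hv : χ ⬝ᵥ v = 0) (hw : χ ⬝ᵥ w = 0)
    (h : crossProduct v w ≠ 0) : ∃ c : F, χ = c • crossProduct v w := by
  obtain ⟨i, hi⟩ := Function.ne_iff.1 h
  refine ⟨χ i / crossProduct v w i, ?_⟩
  simp only [dotProduct, Fin.sum_univ_three] at hv hw
  rw [cross_apply] at hi ⊢
  ext j
  fin_cases i <;> fin_cases j <;> simp at hi ⊢ <;> grind

/-- A normal subgroup of `SL₃(F)` containing a noncentral element is the whole group. -/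
theorem eq_top_of_notMem_center [hY : Y.Normal] {A : SL3 F} (hAY : A ∈ Y)
    (hA : A ∉ Subgroup.center (SL3 F)) : Y = ⊤ := by
  obtain ⟨v, hv⟩ : ∃ v : Fin 3 → F,
      crossProduct v ((A : Matrix (Fin 3) (Fin 3) F) *ᵥ v) ≠ 0 := by
    by_contra! h
    exact hA (mem_center_of_cross_mulVec_eq_zero h)
  set M : Matrix (Fin 3) (Fin 3) F := A.1 with hM
  set N : Matrix (Fin 3) (Fin 3) F := (A⁻¹).1 with hN
  have hMN : M * N = 1 := by
    rw [hM, hN, ← Matrix.SpecialLinearGroup.coe_mul, mul_inv_cancel,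
      Matrix.SpecialLinearGroup.coe_one]
  have hNM : N * M = 1 := mul_eq_one_comm.1 hMN
  set w := M *ᵥ v with hw
  set ψ := crossProduct v w with hψ
  set χ := ψ ᵥ* N with hχ
  have hψv : ψ ⬝ᵥ v = 0 := by rw [dotProduct_comm, hψ, dot_self_cross]
  have hψw : ψ ⬝ᵥ w = 0 := by rw [dotProduct_comm, hψ, dot_cross_self]
  have hχw : χ ⬝ᵥ w = 0 := by
    rw [hχ, hw, ← dotProduct_mulVec, mulVec_mulVec, hNM, one_mulVec, hψv]
  have hw0 : w ≠ 0 := by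
    intro h
    rw [hψ, h] at hv
    simp at hv
  have hAm : M ∈ Y.matrices := coe_mem_matrices.2 hAY
  have hC : elation w χ * elation (-v) ψ ∈ Y.matrices := by
    have h1 := conj_mem_matrices (mem_matrices_of_mul_eq_one hAm hMN) (det_elation hψv)
      (elation_mul_neg hψv)
    have h2 := mul_mem hAm h1
    rwa [← mul_assoc, ← mul_assoc, mul_elation_mul hMN] at h2
  by_cases hχv : χ ⬝ᵥ v = 0
  · obtain ⟨c, hc⟩ := eq_smul_of_dotProduct_eq_zero hχv hχw hv
    rw [show elation w χ = elation (c • w) ψ from elation_congr fun i j => by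
      rw [hc]
      simp only [Pi.smul_apply, smul_eq_mul]
      ring, elation_mul_elation_left (by simp [hψv])] at hC
    refine eq_top_of_elation_mem ?_ hv (by simp [hψv, hψw]) hC
    intro h
    rw [← sub_eq_add_neg, sub_eq_zero] at h
    refine hv ?_
    rw [hψ, ← h]
    simp
  · have hchi : χ ≠ 0 := by
      rintro h
      rw [h] at hχv
      simp at hχv
    have h1 := conj_mem_matrices (mem_matrices_of_mul_eq_one hC
      (N := elation v ψ * elation (-w) χ) (by
        rw [mul_assoc, ← mul_assoc (elation (-v) ψ), mul_eq_one_comm.1 (elation_mul_neg hψv),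
          one_mul, elation_mul_neg hχw])) (det_elation hχw) (elation_mul_neg hχw)
    have h2 := mul_mem hC h1
    have h3 : elation w χ * elation (-v) ψ *
        (elation w χ * (elation v ψ * elation (-w) χ) * elation (-w) χ) =
        elation w ((χ ⬝ᵥ v) • ψ) := by
      have h4 := elation_conj (v := -v) (ψ := ψ) (by simp [hψv]) w χ
      rw [neg_neg, hψw, zero_smul, add_zero] at h4
      calc _ = elation w χ * (elation (-v) ψ * elation w χ * elation v ψ) *
            (elation (-w) χ * elation (-w) χ) := by simp only [mul_assoc]
        _ = _ := by
          rw [h4, elation_mul_elation_left (by simp [hχw]), elation_mul_elation_right hχw,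
            show elation (-w + -w) χ = elation w (- χ - χ) from elation_congr fun i j => by
              simp only [Pi.add_apply, Pi.neg_apply, Pi.sub_apply]
              ring, elation_mul_elation_right (by simp [hχw, hψw, add_dotProduct])]
          congr 1
          simp only [dotProduct_neg]
          module
    rw [h3] at h2
    exact eq_top_of_elation_mem hw0 (smul_ne_zero hχv hv) (by simp [hψw]) h2

end normal

section intersection

open Subgroup

variable {G : Type*} [Group G]

lemma mem_closure_insert_of_commute {a : G} (ha : a * a = 1) {s : Set G}
    (hs : ∀ x ∈ s, Commute a x) {g : G} (hg : g ∈ closure (insert a s)) :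
    g ∈ closure s ∨ a * g ∈ closure s := by
  have hinv : a⁻¹ = a := inv_eq_of_mul_eq_one_left ha
  have ha' (y : G) (hy : y ∈ closure s ∨ a * y ∈ closure s) :
      a * y ∈ closure s ∨ a * (a * y) ∈ closure s := by
    rw [← mul_assoc, ha, one_mul]
    exact hy.symm
  have hs' {x : G} (hx : Commute a x) (hxs : x ∈ closure s) (y : G)
      (hy : y ∈ closure s ∨ a * y ∈ closure s) : x * y ∈ closure s ∨ a * (x * y) ∈ closure s := by
    rw [← mul_assoc, hx.eq, mul_assoc]
    exact hy.imp (mul_mem hxs) (mul_mem hxs)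
  induction hg using closure_induction_left with
  | one => exact Or.inl (one_mem _)
  | mul_left x hx y _ ih =>
    rcases hx with rfl | hx
    · exact ha' y ih
    · exact hs' (hs x hx) (subset_closure hx) y ih
  | inv_mul_cancel x hx y _ ih =>
    rcases hx with rfl | hx
    · rw [hinv]
      exact ha' y ih
    · exact hs' (hs x hx).inv_right (inv_mem (subset_closure hx)) y ih

lemma mem_closure_singleton_of_mul_self {a : G} (ha : a * a = 1) {g : G}
    (hg : g ∈ closure {a}) : g = 1 ∨ g = a := by
  rcases mem_closure_insert_of_commute ha (s := ∅) (by simp) (by simpa using hg) with h | h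
  · exact Or.inl (by simpa using h)
  · right
    rw [Subgroup.closure_empty, mem_bot] at h
    exact mul_left_cancel (h.trans ha.symm)

/-- Generators `a, b, c, d` along a string, with the parabolic intersections
from which the whole intersection property follows. -/
structure IsString (a b c d : G) : Prop where
  a_mul : a * a = 1
  b_mul : b * b = 1
  c_mul : c * c = 1
  d_mul : d * d = 1
  ac : Commute a c
  ad : Commute a d
  bd : Commute b d
  middle : closure {a, b, c} ⊓ closure {b, c, d} ≤ closure {b, c}
  left : closure {a, b} ⊓ closure {b, c} ≤ closure {b}
  right : closure {b, c} ⊓ closure {c, d} ≤ closure {c}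
  notMem_left : a ∉ closure {b, c}
  notMem_right : d ∉ closure {b, c}
  ne : b ≠ c

namespace IsString

variable {a b c d : G}

lemma symm (h : IsString a b c d) : IsString d c b a where
  a_mul := h.d_mul
  b_mul := h.c_mul
  c_mul := h.b_mul
  d_mul := h.a_mul
  ac := h.bd.symm
  ad := h.ad.symm
  bd := h.ac.symm
  middle := by
    have := h.middle
    rwa [inf_comm, show ({a, b, c} : Set G) = {c, b, a} by grind,
      show ({b, c, d} : Set G) = {d, c, b} by grind, Set.pair_comm b c] at this
  left := by
    rw [inf_comm, Set.pair_comm d, Set.pair_comm c]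
    exact h.right
  right := by
    rw [inf_comm, Set.pair_comm b a, Set.pair_comm c]
    exact h.left
  notMem_left := Set.pair_comm b c ▸ h.notMem_right
  notMem_right := Set.pair_comm b c ▸ h.notMem_left
  ne := h.ne.symm

lemma abc_inf_acd (h : IsString a b c d) {g : G} (h₁ : g ∈ closure {a, b, c})
    (h₂ : g ∈ closure {a, c, d}) : g ∈ closure {a, c} := by
  have key {x : G} (hx : x ∈ closure {a, b, c}) (hx' : x ∈ closure {c, d}) :
      x ∈ closure {a, c} :=
    closure_mono (by grind) (h.right ⟨h.middle ⟨hx, closure_mono (by grind) hx'⟩, hx'⟩)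
  rcases mem_closure_insert_of_commute h.a_mul (by
    rintro x (rfl | rfl)
    exacts [h.ac, h.ad]) h₂ with h' | h'
  · exact key h₁ h'
  · exact (mul_mem_cancel_left (subset_closure (by simp))).1
      (key (mul_mem (subset_closure (by simp)) h₁) h')

lemma abc_inf_abd (h : IsString a b c d) {g : G} (h₁ : g ∈ closure {a, b, c})
    (h₂ : g ∈ closure {a, b, d}) : g ∈ closure {a, b} := by
  rw [show ({a, b, d} : Set G) = {d, a, b} by grind] at h₂
  rcases mem_closure_insert_of_commute h.d_mul (by
    rintro x (rfl | rfl)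
    exacts [h.ad.symm, h.bd.symm]) h₂ with h' | h'
  · exact h'
  · refine absurd (h.middle ⟨?_, subset_closure (by simp)⟩) h.notMem_right
    exact (mul_mem_cancel_right h₁).1 (closure_mono (by grind) h')

lemma eq_one (h : IsString a b c d) {g : G} (h₁ : g ∈ closure {b}) (h₂ : g ∈ closure {c}) :
    g = 1 := by
  rcases mem_closure_singleton_of_mul_self h.b_mul h₁ with h₁ | h₁
  · exact h₁
  rcases mem_closure_singleton_of_mul_self h.c_mul h₂ with h₂ | h₂
  · exact h₂
  · exact absurd (h₁.symm.trans h₂) h.ne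

lemma ab_inf_cd (h : IsString a b c d) {g : G} (h₁ : g ∈ closure {a, b})
    (h₂ : g ∈ closure {c, d}) : g = 1 := by
  have hbc : g ∈ closure {b, c} :=
    h.middle ⟨closure_mono (by grind) h₁, closure_mono (by grind) h₂⟩
  exact h.eq_one (h.left ⟨h₁, hbc⟩) (h.right ⟨hbc, h₂⟩)

lemma abd_inf_acd (h : IsString a b c d) {g : G} (h₁ : g ∈ closure {a, b, d})
    (h₂ : g ∈ closure {a, c, d}) : g ∈ closure {a, d} := by
  have ha : a ∈ closure {a, d} := subset_closure (by simp)
  have hd : d ∈ closure {a, d} := subset_closure (by simp)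
  have key {x : G} (hx : x ∈ closure {a, b, d}) (hx' : x ∈ closure {c, d}) :
      x ∈ closure {a, d} := by
    rw [show ({a, b, d} : Set G) = {d, a, b} by grind] at hx
    rcases mem_closure_insert_of_commute h.d_mul (by
      rintro x (rfl | rfl)
      exacts [h.ad.symm, h.bd.symm]) hx with h' | h'
    · rw [h.ab_inf_cd h' hx']
      exact one_mem _
    · refine (mul_mem_cancel_left hd).1 ?_
      rw [h.ab_inf_cd h' (mul_mem (subset_closure (by simp)) hx')]
      exact one_mem _
  rcases mem_closure_insert_of_commute h.a_mul (by
    rintro x (rfl | rfl)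
    exacts [h.ac, h.ad]) h₂ with h' | h'
  · exact key h₁ h'
  · exact (mul_mem_cancel_left ha).1 (key (mul_mem (subset_closure (by simp)) h₁) h')

lemma ab_inf_ac (h : IsString a b c d) {g : G} (h₁ : g ∈ closure {a, b})
    (h₂ : g ∈ closure {a, c}) : g ∈ closure {a} := by
  have ha : a ∈ closure {a} := subset_closure (by simp)
  have key {x : G} (hx : x ∈ closure {a, b}) (hx' : x ∈ closure {c}) : x ∈ closure {a} := by
    rw [h.ab_inf_cd hx (closure_mono (by simp) hx')]
    exact one_mem _
  rcases mem_closure_insert_of_commute h.a_mul (by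
    rintro x rfl
    exact h.ac) h₂ with h' | h'
  · exact key h₁ h'
  · exact (mul_mem_cancel_left ha).1 (key (mul_mem (subset_closure (by simp)) h₁) h')

lemma bcd_inf_acd (h : IsString a b c d) {g : G} (h₁ : g ∈ closure {b, c, d})
    (h₂ : g ∈ closure {a, c, d}) : g ∈ closure {c, d} := by
  have := h.symm.abc_inf_abd (g := g)
  rw [show ({d, c, b} : Set G) = {b, c, d} by grind,
    show ({d, c, a} : Set G) = {a, c, d} by grind, Set.pair_comm d c] at this
  exact this h₁ h₂

lemma bcd_inf_abd (h : IsString a b c d) {g : G} (h₁ : g ∈ closure {b, c, d})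
    (h₂ : g ∈ closure {a, b, d}) : g ∈ closure {b, d} := by
  have := h.symm.abc_inf_acd (g := g)
  rw [show ({d, c, b} : Set G) = {b, c, d} by grind,
    show ({d, b, a} : Set G) = {a, b, d} by grind, Set.pair_comm d b] at this
  exact this h₁ h₂

lemma mem_closure_image (h : IsString a b c d)
    (htop : closure (Set.range ![a, b, c, d]) = ⊤) (J : Set (Fin 4)) {g : G}
    (hg : ∀ i ∉ J, g ∈ closure (![a, b, c, d] '' {i}ᶜ)) : g ∈ closure (![a, b, c, d] '' J) := by
  have h0 : ![a, b, c, d] '' {0}ᶜ = {b, c, d} := by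
    ext x
    simp [Fin.exists_fin_succ, eq_comm]
  have h1 : ![a, b, c, d] '' {1}ᶜ = {a, c, d} := by
    ext x
    simp [Fin.exists_fin_succ, eq_comm]
  have h2 : ![a, b, c, d] '' {2}ᶜ = {a, b, d} := by
    ext x
    simp [Fin.exists_fin_succ, eq_comm]
  have h3 : ![a, b, c, d] '' {3}ᶜ = {a, b, c} := by
    ext x
    simp [Fin.exists_fin_succ, eq_comm]
  have ha : 0 ∈ J → a ∈ ![a, b, c, d] '' J := fun hJ => ⟨0, hJ, rfl⟩
  have hb : 1 ∈ J → b ∈ ![a, b, c, d] '' J := fun hJ => ⟨1, hJ, rfl⟩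
  have hc : 2 ∈ J → c ∈ ![a, b, c, d] '' J := fun hJ => ⟨2, hJ, rfl⟩
  have hd : 3 ∈ J → d ∈ ![a, b, c, d] '' J := fun hJ => ⟨3, hJ, rfl⟩
  have htop' : g ∈ closure {a, b, c, d} := by
    rw [show ({a, b, c, d} : Set G) = Set.range ![a, b, c, d] by
      ext x
      simp only [Set.mem_insert_iff, Set.mem_singleton_iff, Set.mem_range, Fin.exists_fin_succ]
      simp [eq_comm], htop]
    exact mem_top g
  have k0 := hg 0
  have k1 := hg 1
  have k2 := hg 2
  have k3 := hg 3
  rw [h0] at k0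
  rw [h1] at k1
  rw [h2] at k2
  rw [h3] at k3
  generalize ![a, b, c, d] '' J = s at *
  have up {u : Set G} (hu : g ∈ closure u) (hus : u ⊆ s) : g ∈ closure s := closure_mono hus hu
  by_cases j0 : 0 ∈ J <;> by_cases j1 : 1 ∈ J <;> by_cases j2 : 2 ∈ J <;> by_cases j3 : 3 ∈ J <;>
    simp only [j0, j1, j2, j3, not_true_eq_false, not_false_eq_true, forall_const,
      IsEmpty.forall_iff] at k0 k1 k2 k3 ha hb hc hd
  · exact up (htop') (by simp [Set.insert_subset_iff, *])
  · exact up (k3) (by simp [Set.insert_subset_iff, *])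
  · exact up (k2) (by simp [Set.insert_subset_iff, *])
  · exact up (h.abc_inf_abd k3 k2) (by simp [Set.insert_subset_iff, *])
  · exact up (k1) (by simp [Set.insert_subset_iff, *])
  · exact up (h.abc_inf_acd k3 k1) (by simp [Set.insert_subset_iff, *])
  · exact up (h.abd_inf_acd k2 k1) (by simp [Set.insert_subset_iff, *])
  · exact up (h.ab_inf_ac (h.abc_inf_abd k3 k2) (h.abc_inf_acd k3 k1)) (by simp [*])
  · exact up (k0) (by simp [Set.insert_subset_iff, *])
  · exact up (h.middle ⟨k3, k0⟩) (by simp [Set.insert_subset_iff, *])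
  · exact up (h.bcd_inf_abd k0 k2) (by simp [Set.insert_subset_iff, *])
  · exact up (h.left ⟨h.abc_inf_abd k3 k2, h.middle ⟨k3, k0⟩⟩) (by simp [*])
  · exact up (h.bcd_inf_acd k0 k1) (by simp [Set.insert_subset_iff, *])
  · exact up (h.right ⟨h.middle ⟨k3, k0⟩, h.bcd_inf_acd k0 k1⟩) (by simp [*])
  · exact up (h.symm.ab_inf_ac (Set.pair_comm c d ▸ h.bcd_inf_acd k0 k1)
        (Set.pair_comm b d ▸ h.bcd_inf_abd k0 k2)) (by simp [*])
  · rw [h.eq_one (h.left ⟨h.abc_inf_abd k3 k2, h.middle ⟨k3, k0⟩⟩)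
      (h.right ⟨h.middle ⟨k3, k0⟩, h.bcd_inf_acd k0 k1⟩)]
    exact one_mem _

lemma inf_closure_image (h : IsString a b c d)
    (htop : closure (Set.range ![a, b, c, d]) = ⊤) (J K : Set (Fin 4)) :
    closure (![a, b, c, d] '' J) ⊓ closure (![a, b, c, d] '' K) =
      closure (![a, b, c, d] '' (J ∩ K)) := by
  refine le_antisymm ?_ (le_inf (closure_mono (Set.image_mono Set.inter_subset_left))
    (closure_mono (Set.image_mono Set.inter_subset_right)))
  rintro g ⟨hJ, hK⟩
  refine h.mem_closure_image htop _ fun i hi => ?_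
  have sub {L : Set (Fin 4)} (hL : i ∉ L) : L ⊆ {i}ᶜ := fun j hj hji => hL (hji ▸ hj)
  by_cases hiJ : i ∈ J
  · exact closure_mono (Set.image_mono (sub fun hiK => hi ⟨hiJ, hiK⟩)) hK
  · exact closure_mono (Set.image_mono (sub hiJ)) hJ

end IsString
end intersection

section string

/-- A primitive cube root of unity and a square root of two, in a field of characteristic
different from `2`, `3` and `5`. -/
structure StringData (F : Type*) [Field F] where
  ω : F
  σ : F
  two_ne : (2 : F) ≠ 0
  three_ne : (3 : F) ≠ 0
  five_ne : (5 : F) ≠ 0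
  hω : ω ^ 2 + ω + 1 = 0
  hσ : σ ^ 2 = 2

namespace StringData

variable {F : Type*} [Field F] (p : StringData F)

/-- A square root of `-3`. -/
def s : F := -(2 * p.ω + 1)

lemma s_sq : p.s ^ 2 = -3 := by
  have := p.hω
  unfold s
  grind

lemma four_ne {F : Type*} [Field F] (p : StringData F) : (4 : F) ≠ 0 := by
  rw [show (4 : F) = 2 * 2 by norm_num]
  exact mul_ne_zero p.two_ne p.two_ne

/-- The form fixed by the first three generators. -/
def D : SL3 F := ⟨!![2, 0, 0; 0, 1, 0; 0, 0, 1 / 2], by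
  have := p.two_ne
  simp [det_fin_three]
  grind⟩

def h (_ : StringData F) : SL3 F := ⟨!![1, 0, 0; 0, -1, 0; 0, 0, -1], by simp [det_fin_three]⟩

def z : SL3 F := ⟨!![p.ω, 0, 0; 0, p.ω, 0; 0, 0, p.ω], by
  have := p.hω
  simp [det_fin_three]
  grind⟩

/-- The form fixed by the last three generators. -/
def D' : SL3 F := ⟨!![2 * p.ω, 0, 0; 0, -p.ω, 0; 0, 0, -p.ω / 2], by
  have := p.two_ne
  have := p.hω
  simp [det_fin_three]
  grind⟩

def R₁ (_ : StringData F) : SL3 F := ⟨!![-1, 0, 0; 0, 1, 0; 0, 0, -1], by simp [det_fin_three]⟩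

def R₂ : SL3 F := ⟨!![-1, 0, 0; 0, -1 / 3, 4 / 3; 0, 2 / 3, 1 / 3], by
  have := p.three_ne
  simp [det_fin_three]
  grind⟩

def r₁ : SL3 F := ⟨!![-1 / 2, 1, -1; 1 / 2, 0, -1; -1 / 4, -1 / 2, -1 / 2], by
  have := p.two_ne
  simp [det_fin_three]
  grind⟩

def r₄ : SL3 F := ⟨!![-1 / 2, 0, -p.s; 0, -1, 0; p.s / 4, 0, 1 / 2], by
  have := p.two_ne
  have := p.s_sq
  simp [det_fin_three]
  grind⟩

def S₀ : SL3 F := ⟨!![-1, 1, -1 / 2; 1, 0, -1 / 2; -1 / 2, -1 / 2, -1 / 4], by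
  have := p.two_ne
  simp [det_fin_three]
  grind⟩

def S₃ : SL3 F := ⟨!![-p.ω, 0, (p.ω + 2) / 2; 0, p.ω, 0; (p.ω + 2) / 2, 0, -p.ω / 4], by
  have := p.two_ne
  have := p.hω
  simp [det_fin_three]
  grind⟩

lemma eq_of_coe_eq {A B : SL3 F} (hAB : (A : Matrix (Fin 3) (Fin 3) F) = B) : A = B :=
  Subtype.ext hAB

lemma D_coe : (p.D : Matrix (Fin 3) (Fin 3) F) = !![2, 0, 0; 0, 1, 0; 0, 0, 1 / 2] := rfl

lemma h_coe : (p.h : Matrix (Fin 3) (Fin 3) F) = !![1, 0, 0; 0, -1, 0; 0, 0, -1] := rfl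

lemma z_coe : (p.z : Matrix (Fin 3) (Fin 3) F) = !![p.ω, 0, 0; 0, p.ω, 0; 0, 0, p.ω] := rfl

lemma D'_coe : (p.D' : Matrix (Fin 3) (Fin 3) F) =
    !![2 * p.ω, 0, 0; 0, -p.ω, 0; 0, 0, -p.ω / 2] := rfl

lemma R₁_coe : (p.R₁ : Matrix (Fin 3) (Fin 3) F) = !![-1, 0, 0; 0, 1, 0; 0, 0, -1] := rfl

lemma R₂_coe : (p.R₂ : Matrix (Fin 3) (Fin 3) F) =
    !![-1, 0, 0; 0, -1 / 3, 4 / 3; 0, 2 / 3, 1 / 3] := rfl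

lemma r₁_coe : (p.r₁ : Matrix (Fin 3) (Fin 3) F) =
    !![-1 / 2, 1, -1; 1 / 2, 0, -1; -1 / 4, -1 / 2, -1 / 2] := rfl

lemma r₄_coe : (p.r₄ : Matrix (Fin 3) (Fin 3) F) =
    !![-1 / 2, 0, -p.s; 0, -1, 0; p.s / 4, 0, 1 / 2] := rfl

lemma S₀_coe : (p.S₀ : Matrix (Fin 3) (Fin 3) F) =
    !![-1, 1, -1 / 2; 1, 0, -1 / 2; -1 / 2, -1 / 2, -1 / 4] := rfl

lemma S₃_coe : (p.S₃ : Matrix (Fin 3) (Fin 3) F) =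
    !![-p.ω, 0, (p.ω + 2) / 2; 0, p.ω, 0; (p.ω + 2) / 2, 0, -p.ω / 4] := rfl

lemma r₁_mul_D : p.r₁ * p.D * p.r₁.transpose = p.D := by
  have := p.two_ne
  refine eq_of_coe_eq ?_
  simp only [Matrix.SpecialLinearGroup.coe_mul, Matrix.SpecialLinearGroup.coe_transpose,
    D_coe, r₁_coe]
  ext i j
  fin_cases i <;> fin_cases j <;> simp [Matrix.mul_apply, Fin.sum_univ_three] <;> grind

lemma R₁_mul_D : p.R₁ * p.D * p.R₁.transpose = p.D := by
  have := p.two_ne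
  refine eq_of_coe_eq ?_
  simp only [Matrix.SpecialLinearGroup.coe_mul, Matrix.SpecialLinearGroup.coe_transpose,
    D_coe, R₁_coe]
  ext i j
  fin_cases i <;> fin_cases j <;> simp [Matrix.mul_apply, Fin.sum_univ_three]

lemma R₂_mul_D : p.R₂ * p.D * p.R₂.transpose = p.D := by
  have := p.two_ne
  have := p.three_ne
  refine eq_of_coe_eq ?_
  simp only [Matrix.SpecialLinearGroup.coe_mul, Matrix.SpecialLinearGroup.coe_transpose,
    D_coe, R₂_coe]
  ext i j
  fin_cases i <;> fin_cases j <;> simp [Matrix.mul_apply, Fin.sum_univ_three] <;> grind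

lemma h_mul_D : p.h * p.D * p.h.transpose = p.D := by
  have := p.two_ne
  refine eq_of_coe_eq ?_
  simp only [Matrix.SpecialLinearGroup.coe_mul, Matrix.SpecialLinearGroup.coe_transpose,
    D_coe, h_coe]
  ext i j
  fin_cases i <;> fin_cases j <;> simp [Matrix.mul_apply, Fin.sum_univ_three]

lemma r₄_mul_D' : p.r₄ * p.D' * p.r₄.transpose = p.D' := by
  have := p.two_ne
  have := p.hω
  refine eq_of_coe_eq ?_
  simp only [Matrix.SpecialLinearGroup.coe_mul, Matrix.SpecialLinearGroup.coe_transpose,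
    D'_coe, r₄_coe, s]
  ext i j
  fin_cases i <;> fin_cases j <;> simp [Matrix.mul_apply, Fin.sum_univ_three] <;> grind

lemma r₁_mul_self : p.r₁ * p.r₁ = 1 := by
  have := p.two_ne
  refine eq_of_coe_eq ?_
  simp only [Matrix.SpecialLinearGroup.coe_mul, Matrix.SpecialLinearGroup.coe_one, r₁_coe]
  ext i j
  fin_cases i <;> fin_cases j <;> simp [Matrix.mul_apply, Fin.sum_univ_three] <;> grind

lemma r₄_mul_self : p.r₄ * p.r₄ = 1 := by
  have := p.four_ne
  have := p.hω
  refine eq_of_coe_eq ?_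
  simp only [Matrix.SpecialLinearGroup.coe_mul, Matrix.SpecialLinearGroup.coe_one, r₄_coe, s]
  ext i j
  fin_cases i <;> fin_cases j <;> simp [Matrix.mul_apply, Fin.sum_univ_three] <;> grind

lemma R₁_mul_self : p.R₁ * p.R₁ = 1 := by
  refine eq_of_coe_eq ?_
  simp only [Matrix.SpecialLinearGroup.coe_mul, Matrix.SpecialLinearGroup.coe_one, R₁_coe]
  ext i j
  fin_cases i <;> fin_cases j <;> simp [Matrix.mul_apply, Fin.sum_univ_three]

lemma R₂_mul_self : p.R₂ * p.R₂ = 1 := by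
  have := p.two_ne
  have := p.three_ne
  refine eq_of_coe_eq ?_
  simp only [Matrix.SpecialLinearGroup.coe_mul, Matrix.SpecialLinearGroup.coe_one, R₂_coe]
  ext i j
  fin_cases i <;> fin_cases j <;> simp [Matrix.mul_apply, Fin.sum_univ_three] <;> grind

lemma h_mul_self : p.h * p.h = 1 := by
  refine eq_of_coe_eq ?_
  simp only [Matrix.SpecialLinearGroup.coe_mul, Matrix.SpecialLinearGroup.coe_one, h_coe]
  ext i j
  fin_cases i <;> fin_cases j <;> simp [Matrix.mul_apply, Fin.sum_univ_three]

lemma D_transpose : p.D = p.D.transpose := by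
  have := p.two_ne
  refine eq_of_coe_eq ?_
  simp only [Matrix.SpecialLinearGroup.coe_transpose,
    D_coe]
  ext i j
  fin_cases i <;> fin_cases j <;> simp []

lemma D'_transpose : p.D' = p.D'.transpose := by
  refine eq_of_coe_eq ?_
  simp only [Matrix.SpecialLinearGroup.coe_transpose, D'_coe]
  ext i j
  fin_cases i <;> fin_cases j <;> simp []

lemma S₀_transpose : p.S₀ = p.S₀.transpose := by
  have := p.two_ne
  refine eq_of_coe_eq ?_
  simp only [Matrix.SpecialLinearGroup.coe_transpose, S₀_coe]
  ext i j
  fin_cases i <;> fin_cases j <;> simp []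

lemma S₃_transpose : p.S₃ = p.S₃.transpose := by
  refine eq_of_coe_eq ?_
  simp only [Matrix.SpecialLinearGroup.coe_transpose, S₃_coe]
  ext i j
  fin_cases i <;> fin_cases j <;> simp []

lemma r₁_mul_D_eq : p.r₁ * p.D = p.S₀ := by
  have := p.two_ne
  have := p.four_ne
  refine eq_of_coe_eq ?_
  simp only [Matrix.SpecialLinearGroup.coe_mul,
    D_coe, r₁_coe, S₀_coe]
  ext i j
  fin_cases i <;> fin_cases j <;> simp [Matrix.mul_apply, Fin.sum_univ_three] <;> grind

lemma r₄_mul_D'_eq : p.r₄ * p.D' = p.S₃ := by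
  have := p.four_ne
  have := p.hω
  refine eq_of_coe_eq ?_
  simp only [Matrix.SpecialLinearGroup.coe_mul, D'_coe, r₄_coe, S₃_coe, s]
  ext i j
  fin_cases i <;> fin_cases j <;> simp [Matrix.mul_apply, Fin.sum_univ_three] <;> grind

lemma D'_eq : p.D' = p.z * p.h * p.D := by
  have := p.two_ne
  refine eq_of_coe_eq ?_
  simp only [Matrix.SpecialLinearGroup.coe_mul,
    D_coe, h_coe, z_coe, D'_coe]
  ext i j
  fin_cases i <;> fin_cases j <;> simp [Matrix.mul_apply, Fin.sum_univ_three] <;> grind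

lemma r₁_commute_R₂ : p.r₁ * p.R₂ = p.R₂ * p.r₁ := by
  have := p.two_ne
  have := p.three_ne
  have := p.four_ne
  refine eq_of_coe_eq ?_
  simp only [Matrix.SpecialLinearGroup.coe_mul, R₂_coe, r₁_coe]
  ext i j
  fin_cases i <;> fin_cases j <;> simp [Matrix.mul_apply, Fin.sum_univ_three] <;> grind

lemma r₄_commute_R₁ : p.r₄ * p.R₁ = p.R₁ * p.r₄ := by
  refine eq_of_coe_eq ?_
  simp only [Matrix.SpecialLinearGroup.coe_mul, R₁_coe, r₄_coe, s]
  ext i j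
  fin_cases i <;> fin_cases j <;> simp [Matrix.mul_apply, Fin.sum_univ_three]

lemma R₁_commute_h : p.R₁ * p.h = p.h * p.R₁ := by
  refine eq_of_coe_eq ?_
  simp only [Matrix.SpecialLinearGroup.coe_mul, h_coe, R₁_coe]
  ext i j
  fin_cases i <;> fin_cases j <;> simp [Matrix.mul_apply, Fin.sum_univ_three]

lemma R₂_commute_h : p.R₂ * p.h = p.h * p.R₂ := by
  have := p.two_ne
  refine eq_of_coe_eq ?_
  simp only [Matrix.SpecialLinearGroup.coe_mul, h_coe, R₂_coe]
  ext i j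
  fin_cases i <;> fin_cases j <;> simp [Matrix.mul_apply, Fin.sum_univ_three]

lemma S₀_eq : p.S₀ = p.z * p.z * (p.r₁ * p.h * p.r₄) * p.S₃ := by
  have := p.two_ne
  have := p.four_ne
  have := p.hω
  refine eq_of_coe_eq ?_
  simp only [Matrix.SpecialLinearGroup.coe_mul, h_coe, z_coe, r₁_coe, r₄_coe, S₀_coe, S₃_coe, s]
  ext i j
  fin_cases i <;> fin_cases j <;> simp [Matrix.mul_apply, Fin.sum_univ_three] <;> grind

lemma S₃_eq : p.S₃ = p.z * p.z * (p.r₁ * p.h * p.r₄) * p.S₀ := by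
  have := p.two_ne
  have := p.four_ne
  have := p.hω
  refine eq_of_coe_eq ?_
  simp only [Matrix.SpecialLinearGroup.coe_mul, h_coe, z_coe, r₁_coe, r₄_coe, S₀_coe, S₃_coe, s]
  ext i j
  fin_cases i <;> fin_cases j <;> simp [Matrix.mul_apply, Fin.sum_univ_three] <;> grind

end StringData
end string

section relations

namespace StringData

variable {F : Type*} [Field F] (p : StringData F)

lemma r₁_braid : p.r₁ * (p.R₁ * p.h) * p.r₁ = p.R₁ * p.h * p.r₁ * (p.R₁ * p.h) := by
  have := p.two_ne
  refine eq_of_coe_eq ?_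
  simp only [Matrix.SpecialLinearGroup.coe_mul, h_coe, R₁_coe, r₁_coe]
  ext i j
  fin_cases i <;> fin_cases j <;> simp [Matrix.mul_apply, Fin.sum_univ_three] <;> grind

lemma r₄_braid : p.r₄ * (p.R₂ * p.h) * p.r₄ = p.R₂ * p.h * p.r₄ * (p.R₂ * p.h) := by
  have := p.two_ne
  have := p.three_ne
  have := p.hω
  refine eq_of_coe_eq ?_
  simp only [Matrix.SpecialLinearGroup.coe_mul, h_coe, R₂_coe, r₄_coe, s]
  ext i j
  fin_cases i <;> fin_cases j <;> simp [Matrix.mul_apply, Fin.sum_univ_three] <;> grind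

lemma r₁_braid_R₁ : p.r₁ * p.R₁ * (p.r₁ * p.R₁) = p.R₁ * p.r₁ * (p.R₁ * p.r₁) := by
  have := p.two_ne
  have := p.four_ne
  refine eq_of_coe_eq ?_
  simp only [Matrix.SpecialLinearGroup.coe_mul, R₁_coe, r₁_coe]
  ext i j
  fin_cases i <;> fin_cases j <;> simp [Matrix.mul_apply, Fin.sum_univ_three] <;> grind

lemma r₄_braid_R₂ : p.r₄ * p.R₂ * (p.r₄ * p.R₂) = p.R₂ * p.r₄ * (p.R₂ * p.r₄) := by
  have := p.two_ne
  have := p.four_ne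
  have := p.hω
  refine eq_of_coe_eq ?_
  simp only [Matrix.SpecialLinearGroup.coe_mul, R₂_coe, r₄_coe, s]
  ext i j
  fin_cases i <;> fin_cases j <;> simp [Matrix.mul_apply, Fin.sum_univ_three] <;> grind

lemma r₁_conj_h_ne : p.r₁ * p.R₁ * p.r₁ * p.h ≠ p.h * (p.r₁ * p.R₁ * p.r₁) := by
  have := p.two_ne
  have := p.four_ne
  intro heq
  have hij := congrArg (fun A : SL3 F => (A : Matrix (Fin 3) (Fin 3) F) 0 2) heq
  simp [Matrix.mul_apply, Fin.sum_univ_three, h_coe, R₁_coe, r₁_coe] at hij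
  grind

lemma r₄_conj_h_ne : p.r₄ * p.R₂ * p.r₄ * p.h ≠ p.h * (p.r₄ * p.R₂ * p.r₄) := by
  have := p.two_ne
  have := p.three_ne
  have := p.hω
  intro heq
  have hij := congrArg (fun A : SL3 F => (A : Matrix (Fin 3) (Fin 3) F) 0 1) heq
  simp [Matrix.mul_apply, Fin.sum_univ_three, h_coe, R₂_coe, r₄_coe, s] at hij
  have hω : p.ω = -2 := mul_left_cancel₀ p.four_ne (by grind)
  grind

lemma R₁_mul_D' : p.R₁ * p.D' * p.R₁.transpose = p.D' := by
  refine eq_of_coe_eq ?_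
  simp only [Matrix.SpecialLinearGroup.coe_mul, Matrix.SpecialLinearGroup.coe_transpose, D'_coe,
    R₁_coe]
  ext i j
  fin_cases i <;> fin_cases j <;> simp [Matrix.mul_apply, Fin.sum_univ_three]

lemma R₂_mul_D' : p.R₂ * p.D' * p.R₂.transpose = p.D' := by
  have := p.two_ne
  have := p.three_ne
  refine eq_of_coe_eq ?_
  simp only [Matrix.SpecialLinearGroup.coe_mul, Matrix.SpecialLinearGroup.coe_transpose,
    D'_coe, R₂_coe]
  ext i j
  fin_cases i <;> fin_cases j <;> simp [Matrix.mul_apply, Fin.sum_univ_three] <;> grind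

/-- An element of the torus fixing the form `D`. -/
def rot (a b : F) : Matrix (Fin 3) (Fin 3) F := !![1, 0, 0; 0, a, -2 * b; 0, b, a]

lemma rot_mul_rot (a b a' b' : F) :
    rot a b * rot a' b' = rot (a * a' - 2 * b * b') (a * b' + b * a') := by
  ext i j
  fin_cases i <;> fin_cases j <;> simp [rot, Matrix.mul_apply, Fin.sum_univ_three] <;> ring

lemma rot_one_zero : rot (1 : F) 0 = 1 := by
  ext i j
  fin_cases i <;> fin_cases j <;> simp [rot]

lemma rot_injective {a b a' b' : F} (h : rot a b = rot a' b') : a = a' ∧ b = b' :=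
  ⟨by simpa [rot] using congr_fun₂ h 1 1, by simpa [rot] using congr_fun₂ h 2 1⟩

lemma R₁_mul_R₂_coe :
    ((p.R₁ * p.R₂ : SL3 F) : Matrix (Fin 3) (Fin 3) F) = rot (-1 / 3) (-2 / 3) := by
  have := p.three_ne
  rw [Matrix.SpecialLinearGroup.coe_mul, R₁_coe, R₂_coe]
  ext i j
  fin_cases i <;> fin_cases j <;> simp [rot, Matrix.mul_apply, Fin.sum_univ_three] <;> grind

/-- Commuting with `h` means being block diagonal. -/
lemma apply_eq_zero_of_commute_h {A : SL3 F} (hA : A * p.h = p.h * A) :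
    A 0 1 = 0 ∧ A 0 2 = 0 ∧ A 1 0 = 0 ∧ A 2 0 = 0 := by
  have := p.two_ne
  have key (i j : Fin 3) := congrArg (fun A : SL3 F => (A : Matrix (Fin 3) (Fin 3) F) i j) hA
  have h1 := key 0 1
  have h2 := key 0 2
  have h3 := key 1 0
  have h4 := key 2 0
  simp [Matrix.mul_apply, Fin.sum_univ_three, h_coe] at h1 h2 h3 h4
  grind

lemma coe_eq_rot {A : SL3 F} (hA : A * p.h = p.h * A) (hD : A * p.D * A.transpose = p.D)
    (h0 : A 0 0 = 1) : (A : Matrix (Fin 3) (Fin 3) F) = rot (A 1 1) (A 2 1) ∧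
      A 1 1 ^ 2 + 2 * A 2 1 ^ 2 = 1 := by
  have := p.two_ne
  obtain ⟨h01, h02, h10, h20⟩ := p.apply_eq_zero_of_commute_h hA
  have hdet : A 0 0 * (A 1 1 * A 2 2 - A 1 2 * A 2 1) = 1 := by
    have := A.2
    rw [det_fin_three] at this
    grind
  have key (i j : Fin 3) := congrArg (fun A : SL3 F => (A : Matrix (Fin 3) (Fin 3) F) i j) hD
  have h1 := key 1 1
  have h2 := key 1 2
  have h3 := key 2 2
  simp [Matrix.mul_apply, Fin.sum_univ_three, D_coe, h10, h20] at h1 h2 h3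
  have h22 : A 2 2 = A 1 1 := by grind
  have h12 : A 1 2 = -2 * A 2 1 := by grind
  constructor
  · ext i j
    fin_cases i <;> fin_cases j <;> simp [rot, *]
  · grind

lemma apply_zero_zero_sq {A : SL3 F} (hA : A * p.h = p.h * A)
    (hD : A * p.D * A.transpose = p.D) : A 0 0 = 1 ∨ A 0 0 = -1 := by
  have := p.two_ne
  obtain ⟨h01, h02, h10, h20⟩ := p.apply_eq_zero_of_commute_h hA
  have h1 := congrArg (fun A : SL3 F => (A : Matrix (Fin 3) (Fin 3) F) 0 0) hD
  simp [Matrix.mul_apply, Fin.sum_univ_three, D_coe, h01, h02] at h1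
  grind

end StringData
end relations

section corner

open Subgroup

variable {G : Type*} [Group G]

/-- The configuration at one end of the string: the end generator is `r * c`, its neighbour is
`a`, and the next generator is `b`. -/
structure IsStringEnd (I : Subgroup G) (c r a b h : G) : Prop where
  c_mul : c * c = 1
  r_mul : r * r = 1
  a_mul : a * a = 1
  h_mul : h * h = 1
  rc : Commute r c
  ac : Commute a c
  bc : Commute b c
  rb : Commute r b
  ah : Commute a h
  bh : Commute b h
  braid : r * (a * h) * r = a * h * r * (a * h)
  square : r * a * (r * a) = a * r * (a * r)
  not_commute : ¬ Commute (r * a * r) h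
  h_mem : h ∈ closure {a, b}
  r_mem : r ∈ I
  a_mem : a ∈ I
  b_mem : b ∈ I
  c_notMem : c ∉ I

lemma mem_closure_pair_of_pow_four {t a : G} (ht : t * t = 1) (ha : a * a = 1)
    (hta : t * a * (t * a) = a * t * (a * t)) {g : G} (hg : g ∈ closure {t, a}) :
    ∃ e x, (e = 1 ∨ e = t) ∧ (x = 1 ∨ x = a ∨ x = t * a * t ∨ x = a * (t * a * t)) ∧
      g = e * x := by
  have ht' : t⁻¹ = t := inv_eq_of_mul_eq_one_left ht
  have ha' : a⁻¹ = a := inv_eq_of_mul_eq_one_left ha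
  have hta' : t * a * t * a = a * t * a * t := by simpa only [mul_assoc] using hta
  have tt (x : G) : t * (t * x) = x := by rw [← mul_assoc, ht, one_mul]
  have aa (x : G) : a * (a * x) = x := by rw [← mul_assoc, ha, one_mul]
  have key {y g : G} (hy : y ∈ ({t, a} : Set G))
      (hg : ∃ e x, (e = 1 ∨ e = t) ∧ (x = 1 ∨ x = a ∨ x = t * a * t ∨ x = a * (t * a * t)) ∧
        g = e * x) :
      ∃ e x, (e = 1 ∨ e = t) ∧ (x = 1 ∨ x = a ∨ x = t * a * t ∨ x = a * (t * a * t)) ∧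
        y * g = e * x := by
    obtain ⟨e, x, he, hx, rfl⟩ := hg
    rcases hy with rfl | rfl
    · rcases he with rfl | rfl
      · exact ⟨y, x, Or.inr rfl, hx, by rw [one_mul]⟩
      · exact ⟨1, x, Or.inl rfl, hx, by rw [tt, one_mul]⟩
    · rcases he with rfl | rfl
      · refine ⟨1, y * x, Or.inl rfl, ?_, by simp⟩
        rcases hx with rfl | rfl | rfl | rfl
        · simp
        · simp [ha]
        · simp
        · simp [aa]
      · refine ⟨e, e * y * e * x, Or.inr rfl, ?_, by simp only [mul_assoc, tt]⟩
        rcases hx with rfl | rfl | rfl | rfl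
        · simp
        · right; right; right
          rw [hta']; simp only [mul_assoc]
        · left
          simp only [mul_assoc, tt, aa, ht]
        · right; left
          rw [← mul_assoc, hta']
          simp only [mul_assoc, tt, aa, ht, mul_one]
  induction hg using closure_induction_left with
  | one => exact ⟨1, 1, Or.inl rfl, Or.inl rfl, by simp⟩
  | mul_left x hx y _ ih => exact key hx ih
  | inv_mul_cancel x hx y _ ih =>
    refine key ?_ ih
    rcases hx with rfl | rfl
    · simp [ht']
    · simp [Set.mem_singleton_iff.1, ha']

namespace IsStringEnd

variable {I : Subgroup G} {c r a b h : G}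

lemma mul_self (H : IsStringEnd I c r a b h) : r * c * (r * c) = 1 := by
  rw [H.rc.symm.mul_mul_mul_comm, H.r_mul, H.c_mul, one_mul]

lemma commute (H : IsStringEnd I c r a b h) : Commute (r * c) b :=
  H.rb.mul_left H.bc.symm

lemma hc (H : IsStringEnd I c r a b h) : Commute h c := by
  have : closure {a, b} ≤ centralizer {c} := by
    rw [closure_le]
    rintro x (rfl | rfl)
    · exact mem_centralizer_singleton_iff.2 H.ac.eq
    · exact mem_centralizer_singleton_iff.2 H.bc.eq
  exact mem_centralizer_singleton_iff.1 (this H.h_mem)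

lemma commute_of_mem (H : IsStringEnd I c r a b h) {g : G} (hg : g ∈ closure {r * c, a, b}) :
    Commute g c := by
  have : closure {r * c, a, b} ≤ centralizer {c} := by
    rw [closure_le]
    rintro x (rfl | rfl | rfl)
    · exact mem_centralizer_singleton_iff.2 (H.rc.mul_left (Commute.refl c)).eq
    · exact mem_centralizer_singleton_iff.2 H.ac.eq
    · exact mem_centralizer_singleton_iff.2 H.bc.eq
  exact mem_centralizer_singleton_iff.1 (this hg)

lemma commute_h_of_mem (H : IsStringEnd I c r a b h) {g : G} (hg : g ∈ closure {a, b}) :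
    Commute g h := by
  have : closure {a, b} ≤ centralizer {h} := by
    rw [closure_le]
    rintro x (rfl | rfl)
    · exact mem_centralizer_singleton_iff.2 H.ah.eq
    · exact mem_centralizer_singleton_iff.2 H.bh.eq
  exact mem_centralizer_singleton_iff.1 (this hg)

lemma closure_le_inner (H : IsStringEnd I c r a b h) : closure {a, b} ≤ I := by
  rw [closure_le]
  rintro x (rfl | rfl)
  exacts [H.a_mem, H.b_mem]

lemma mul_notMem (H : IsStringEnd I c r a b h) : r * c ∉ I := fun h =>
  H.c_notMem ((mul_mem_cancel_left H.r_mem).1 h)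

lemma mul_conj (H : IsStringEnd I c r a b h) : r * c * a * (r * c) = r * a * r := by
  rw [mul_assoc r c a, ← H.ac.eq, H.rc.eq, ← mul_assoc, mul_assoc r, mul_assoc a, mul_assoc r,
    mul_assoc a, H.c_mul, one_mul, mul_assoc]

lemma square' (H : IsStringEnd I c r a b h) :
    r * c * a * (r * c * a) = a * (r * c) * (a * (r * c)) := by
  have h1 : r * c * a * (r * c * a) = r * a * r * a := by rw [← H.mul_conj, ← mul_assoc]
  have h2 : a * (r * c) * (a * (r * c)) = a * (r * a * r) := by
    rw [← H.mul_conj]; simp only [mul_assoc]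
  rw [h1, h2]
  simpa only [mul_assoc] using H.square

lemma orderOf_mul (H : IsStringEnd I c r a b h) : orderOf (r * c * a) = 4 := by
  refine orderOf_eq_prime_pow (p := 2) (n := 1) ?_ ?_
  · rw [pow_one, pow_two, ← mul_assoc, H.mul_conj]
    intro h1
    refine H.not_commute ?_
    rw [mul_eq_one_iff_eq_inv.1 h1, inv_eq_of_mul_eq_one_left H.a_mul]
    exact H.ah
  · rw [show 2 ^ (1 + 1) = 2 + 2 by norm_num, pow_add, pow_two]
    nth_rewrite 2 [H.square']
    have := H.mul_self
    have tt (x : G) : r * c * (r * c * x) = x := by rw [← mul_assoc, this, one_mul]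
    have aa (x : G) : a * (a * x) = x := by rw [← mul_assoc, H.a_mul, one_mul]
    generalize r * c = t at *
    simp only [mul_assoc, aa, tt, this]

lemma c_mem (H : IsStringEnd I c r a b h) : c ∈ closure {r * c, a, b} := by
  have ht : r * c ∈ closure {r * c, a, b} := subset_closure (by simp)
  have hk : a * h ∈ closure {r * c, a, b} :=
    mul_mem (subset_closure (by simp)) (closure_mono (by grind) H.h_mem)
  have hkc : Commute (a * h) c := H.ac.mul_left H.hc
  have hrk : Commute (r * (a * h)) c := H.rc.mul_left hkc
  have hkk : a * h * (a * h) = 1 := by rw [H.ah.symm.mul_mul_mul_comm, H.a_mul, H.h_mul, one_mul]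
  have hbr := H.braid
  have key : (r * c * (a * h)) ^ 3 = c := by
    rw [mul_assoc, ← hkc.eq, ← mul_assoc, hrk.mul_pow]
    generalize a * h = k at *
    have h3 : (r * k) ^ 3 = r * k * r * (k * r * k) := by simp only [pow_three, mul_assoc]
    have kk (x : G) : k * (k * x) = x := by rw [← mul_assoc, hkk, one_mul]
    have rr (x : G) : r * (r * x) = x := by rw [← mul_assoc, H.r_mul, one_mul]
    rw [h3, hbr, pow_three, H.c_mul, mul_one]
    simp only [mul_assoc, kk, rr, hkk, one_mul]
  have hmem := pow_mem (mul_mem ht hk) 3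
  rwa [key] at hmem

lemma left (H : IsStringEnd I c r a b h) :
    closure {r * c, a} ⊓ closure {a, b} ≤ closure {a} := by
  rintro g ⟨h1, h2⟩
  obtain ⟨e, x, he, hx, rfl⟩ := mem_closure_pair_of_pow_four H.mul_self H.a_mul H.square' h1
  rw [H.mul_conj] at hx
  have hxI : x ∈ I := by
    rcases hx with rfl | rfl | rfl | rfl
    · exact one_mem _
    · exact H.a_mem
    · exact mul_mem (mul_mem H.r_mem H.a_mem) H.r_mem
    · exact mul_mem H.a_mem (mul_mem (mul_mem H.r_mem H.a_mem) H.r_mem)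
  rcases he with rfl | rfl
  · rw [one_mul] at h2 ⊢
    have hcomm := H.commute_h_of_mem h2
    rcases hx with rfl | rfl | rfl | rfl
    · exact one_mem _
    · exact subset_closure rfl
    · exact absurd hcomm H.not_commute
    · refine absurd ?_ H.not_commute
      have := H.ah.inv_left.mul_left hcomm
      rwa [inv_mul_cancel_left] at this
  · exact absurd ((mul_mem_cancel_right hxI).1 (H.closure_le_inner h2)) H.mul_notMem

end IsStringEnd
end corner

section generators

open Subgroup

namespace StringData

variable {F G : Type*} [Field F] [Group G] {ι : SL3 F →* G} {τ : G} (p : StringData F)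

/-- The product of the two middle generators generates the whole torus. -/
def HasCyclicTorus (F : Type*) [Field F] : Prop :=
  ∀ a b : F, a ^ 2 + 2 * b ^ 2 = 1 → ∃ k : ℕ, rot a b = rot (-1 / 3) (-2 / 3) ^ k

lemma mem_closure_R (hF : HasCyclicTorus F) {A : SL3 F} (hA : A * p.h = p.h * A)
    (hD : A * p.D * A.transpose = p.D) : A ∈ closure {p.R₁, p.R₂} := by
  have h1 : p.R₁ ∈ closure {p.R₁, p.R₂} := subset_closure (by simp)
  have h2 : p.R₂ ∈ closure {p.R₁, p.R₂} := subset_closure (by simp)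
  have key {B : SL3 F} (hB : B * p.h = p.h * B) (hBD : B * p.D * B.transpose = p.D)
      (hB0 : B 0 0 = 1) : B ∈ closure {p.R₁, p.R₂} := by
    obtain ⟨hrot, hn⟩ := p.coe_eq_rot hB hBD hB0
    obtain ⟨k, hk⟩ := hF _ _ hn
    have : B = (p.R₁ * p.R₂) ^ k := by
      refine eq_of_coe_eq ?_
      rw [Matrix.SpecialLinearGroup.coe_pow, R₁_mul_R₂_coe, hrot, hk]
    rw [this]
    exact pow_mem (mul_mem h1 h2) k
  rcases p.apply_zero_zero_sq hA hD with h0 | h0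
  · exact key hA hD h0
  · refine (mul_mem_cancel_right h1).1 (key ?_ ?_ ?_)
    · rw [mul_assoc, p.R₁_commute_h, ← mul_assoc, hA, mul_assoc]
    · rw [show (A * p.R₁).transpose = p.R₁.transpose * A.transpose from
        eq_of_coe_eq (by simp [Matrix.transpose_mul])]
      calc _ = A * (p.R₁ * p.D * p.R₁.transpose) * A.transpose := by simp only [mul_assoc]
        _ = _ := by rw [p.R₁_mul_D, hD]
    · simp [Matrix.mul_apply, Fin.sum_univ_three, R₁_coe, h0]

lemma map_mem_closure {A B C : SL3 F} (hA : A ∈ closure {B, C}) :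
    ι A ∈ closure {ι B, ι C} := by
  rw [← Set.image_pair, ← MonoidHom.map_closure]
  exact mem_map_of_mem ι hA

lemma h_mem (hF : HasCyclicTorus F) : p.h ∈ closure {p.R₁, p.R₂} :=
  p.mem_closure_R hF rfl p.h_mul_D

lemma isStringEnd_left (hE : IsTransposeInverseExtension ι τ) (hF : HasCyclicTorus F) :
    IsStringEnd ι.range (ι p.D * τ) (ι p.r₁) (ι p.R₁) (ι p.R₂) (ι p.h) where
  c_mul := hE.outer_mul_self p.D_transpose
  r_mul := by rw [← map_mul, p.r₁_mul_self, map_one]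
  a_mul := by rw [← map_mul, p.R₁_mul_self, map_one]
  h_mul := by rw [← map_mul, p.h_mul_self, map_one]
  rc := (hE.commute_iff _ _).2 p.r₁_mul_D
  ac := (hE.commute_iff _ _).2 p.R₁_mul_D
  bc := (hE.commute_iff _ _).2 p.R₂_mul_D
  rb := by rw [commute_iff_eq, ← map_mul, ← map_mul, p.r₁_commute_R₂]
  ah := by rw [commute_iff_eq, ← map_mul, ← map_mul, p.R₁_commute_h]
  bh := by rw [commute_iff_eq, ← map_mul, ← map_mul, p.R₂_commute_h]
  braid := by simp only [← map_mul, p.r₁_braid]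
  square := by simp only [← map_mul, p.r₁_braid_R₁]
  not_commute := by
    simp only [commute_iff_eq, ← map_mul]
    exact fun h => p.r₁_conj_h_ne (hE.injective h)
  h_mem := map_mem_closure (p.h_mem hF)
  r_mem := ⟨_, rfl⟩
  a_mem := ⟨_, rfl⟩
  b_mem := ⟨_, rfl⟩
  c_notMem := fun ⟨A, hA⟩ => hE.inner_ne_outer A _ hA

lemma isStringEnd_right (hE : IsTransposeInverseExtension ι τ) (hF : HasCyclicTorus F) :
    IsStringEnd ι.range (ι p.D' * τ) (ι p.r₄) (ι p.R₂) (ι p.R₁) (ι p.h) where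
  c_mul := hE.outer_mul_self p.D'_transpose
  r_mul := by rw [← map_mul, p.r₄_mul_self, map_one]
  a_mul := by rw [← map_mul, p.R₂_mul_self, map_one]
  h_mul := by rw [← map_mul, p.h_mul_self, map_one]
  rc := (hE.commute_iff _ _).2 p.r₄_mul_D'
  ac := (hE.commute_iff _ _).2 p.R₂_mul_D'
  bc := (hE.commute_iff _ _).2 p.R₁_mul_D'
  rb := by rw [commute_iff_eq, ← map_mul, ← map_mul, p.r₄_commute_R₁]
  ah := by rw [commute_iff_eq, ← map_mul, ← map_mul, p.R₂_commute_h]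
  bh := by rw [commute_iff_eq, ← map_mul, ← map_mul, p.R₁_commute_h]
  braid := by simp only [← map_mul, p.r₄_braid]
  square := by simp only [← map_mul, p.r₄_braid_R₂]
  not_commute := by
    simp only [commute_iff_eq, ← map_mul]
    exact fun h => p.r₄_conj_h_ne (hE.injective h)
  h_mem := Set.pair_comm (ι p.R₁) (ι p.R₂) ▸ map_mem_closure (p.h_mem hF)
  r_mem := ⟨_, rfl⟩
  a_mem := ⟨_, rfl⟩
  b_mem := ⟨_, rfl⟩
  c_notMem := fun ⟨A, hA⟩ => hE.inner_ne_outer A _ hA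

lemma ω_sq_ne : p.ω ^ 2 ≠ 1 ∧ p.ω ^ 2 ≠ -1 := by
  have := p.three_ne
  have := p.hω
  constructor <;> intro <;> grind

lemma not_outer_commute (A : SL3 F) : A ≠ p.z * p.h * A * (p.z * p.h).transpose := by
  intro hA
  have hω := p.ω_sq_ne
  have key (i j : Fin 3) := congrArg (fun A : SL3 F => (A : Matrix (Fin 3) (Fin 3) F) i j) hA
  simp only [Matrix.SpecialLinearGroup.coe_mul, Matrix.SpecialLinearGroup.coe_transpose, z_coe,
    h_coe] at key
  have h1 := key 0 0
  have h2 := key 0 1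
  have h3 := key 0 2
  simp [Matrix.mul_apply, Matrix.vecMul, dotProduct, Fin.sum_univ_three] at h1 h2 h3
  clear key hA
  have h1' : A 0 0 = 0 := by grind
  have h2' : A 0 1 = 0 := by grind
  have h3' : A 0 2 = 0 := by grind
  have hdet := A.2
  rw [det_fin_three] at hdet
  simp [h1', h2', h3'] at hdet

lemma mem_middle (hE : IsTransposeInverseExtension ι τ) (hF : HasCyclicTorus F) {g : G}
    (hc : Commute g (ι p.D * τ)) (hc' : Commute g (ι p.D' * τ)) :
    g ∈ closure {ι p.R₁, ι p.R₂} := by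
  have hcc := hc'.mul_right hc
  rw [hE.outer_mul_outer_eq (C := p.z * p.h) (by rw [← p.D_transpose, p.D'_eq])] at hcc
  obtain ⟨A, rfl | rfl⟩ := hE.cover g
  · rw [hE.commute_iff] at hc
    rw [commute_iff_eq, ← map_mul, ← map_mul, hE.injective.eq_iff] at hcc
    have hz : A * p.z = p.z * A := by
      refine eq_of_coe_eq ?_
      have hz : (p.z : Matrix (Fin 3) (Fin 3) F) = p.ω • 1 := by
        rw [z_coe]
        ext i j
        fin_cases i <;> fin_cases j <;> simp
      rw [Matrix.SpecialLinearGroup.coe_mul, Matrix.SpecialLinearGroup.coe_mul, hz]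
      simp
    rw [← mul_assoc, hz, mul_assoc, mul_assoc] at hcc
    exact map_mem_closure (p.mem_closure_R hF (mul_left_cancel hcc) hc)
  · rw [commute_iff_eq, hE.outer_mul_inner, ← mul_assoc, ← map_mul, mul_left_inj,
      hE.injective.eq_iff, mul_inv_eq_iff_eq_mul] at hcc
    exact absurd hcc (p.not_outer_commute A)

lemma S₀_map : ι p.S₀ * τ = ι p.r₁ * (ι p.D * τ) := by
  rw [← mul_assoc, ← map_mul, p.r₁_mul_D_eq]

lemma S₃_map : ι p.S₃ * τ = ι p.r₄ * (ι p.D' * τ) := by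
  rw [← mul_assoc, ← map_mul, p.r₄_mul_D'_eq]

lemma isString (hE : IsTransposeInverseExtension ι τ) (hF : HasCyclicTorus F) :
    IsString (ι p.S₀ * τ) (ι p.R₁) (ι p.R₂) (ι p.S₃ * τ) := by
  have hL := p.isStringEnd_left hE hF
  have hR := p.isStringEnd_right hE hF
  have had : Commute (ι p.S₀ * τ) (ι p.S₃ * τ) :=
    hE.outer_commute_outer (C := p.z * p.z * (p.r₁ * p.h * p.r₄))
      (by rw [← p.S₃_transpose, p.S₀_eq]) (by rw [← p.S₀_transpose, p.S₃_eq])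
  rw [S₀_map, S₃_map] at *
  exact {
    a_mul := hL.mul_self
    b_mul := hL.a_mul
    c_mul := hR.a_mul
    d_mul := hR.mul_self
    ac := hL.commute
    ad := had
    bd := hR.commute.symm
    middle := by
      rintro g ⟨h1, h2⟩
      refine p.mem_middle hE hF (hL.commute_of_mem h1) (hR.commute_of_mem ?_)
      rwa [show ({ι p.r₄ * (ι p.D' * τ), ι p.R₂, ι p.R₁} : Set G) =
        {ι p.R₁, ι p.R₂, ι p.r₄ * (ι p.D' * τ)} by grind]
    left := hL.left
    right := by
      rw [inf_comm, Set.pair_comm _ (ι p.r₄ * _), Set.pair_comm (ι p.R₁)]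
      exact hR.left
    notMem_left := fun h => hL.mul_notMem (hL.closure_le_inner h)
    notMem_right := fun h => hR.mul_notMem (hL.closure_le_inner h)
    ne := fun h => by
      have := p.four_ne
      have := p.three_ne
      have h1 := congrArg (fun A : SL3 F => (A : Matrix (Fin 3) (Fin 3) F) 1 2)
        (hE.injective h)
      simp [R₁_coe, R₂_coe] at h1
      grind }

end StringData
end generators

section generation

variable {F : Type*} [Field F] {Y : Subgroup (SL3 F)}

lemma mem_matrices_of_mul_mem {M N : Matrix (Fin 3) (Fin 3) F} (hN : N ∈ Y.matrices)
    (h : M * N ∈ Y.matrices) : M ∈ Y.matrices := by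
  obtain ⟨A, hA, rfl⟩ := hN
  obtain ⟨B, hB, hBM⟩ := h
  refine ⟨B * A⁻¹, Y.mul_mem hB (Y.inv_mem hA), ?_⟩
  rw [map_mul, hBM, mul_assoc, ← map_mul, mul_inv_cancel, map_one, mul_one]

namespace StringData

variable (p : StringData F)

lemma rot_mem (hF : HasCyclicTorus F) (h₁ : p.R₁ ∈ Y) (h₂ : p.R₂ ∈ Y) {a b : F}
    (hab : a ^ 2 + 2 * b ^ 2 = 1) : rot a b ∈ Y.matrices := by
  obtain ⟨k, hk⟩ := hF a b hab
  rw [hk, ← p.R₁_mul_R₂_coe]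
  exact pow_mem (coe_mem_matrices.2 (mul_mem h₁ h₂)) k

lemma R₁_mul_rot_mem (hF : HasCyclicTorus F) (h₁ : p.R₁ ∈ Y) (h₂ : p.R₂ ∈ Y) {a b : F}
    (hab : a ^ 2 + 2 * b ^ 2 = 1) : !![-1, 0, 0; 0, a, -2 * b; 0, -b, -a] ∈ Y.matrices := by
  have := mul_mem (coe_mem_matrices.2 h₁) (p.rot_mem hF h₁ h₂ hab)
  convert this using 1
  rw [R₁_coe, rot]
  ext i j
  fin_cases i <;> fin_cases j <;> simp [Matrix.mul_apply, Fin.sum_univ_three]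

lemma reflection₄_mem (hF : HasCyclicTorus F) (h₁ : p.R₁ ∈ Y) (h₂ : p.R₂ ∈ Y) (h₄ : p.r₄ ∈ Y) :
    !![-4, 6, 2 * p.s; -3, 5, 2 * p.s; -p.s / 2, p.s, -2] ∈ Y.matrices := by
  have hs := p.s_sq
  have h0 := p.two_ne
  have h0' := p.four_ne
  have hab : (5 : F) ^ 2 + 2 * (2 * p.s) ^ 2 = 1 := by grind
  have h4 := coe_mem_matrices.2 h₄
  have := mul_mem (mul_mem h4 (p.R₁_mul_rot_mem hF h₁ h₂ hab)) h4
  convert this using 1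
  rw [r₄_coe]
  ext i j
  fin_cases i <;> fin_cases j <;> simp [Matrix.mul_apply, Fin.sum_univ_three] <;> grind

lemma reflection₁_mem (hF : HasCyclicTorus F) (h₁ : p.R₁ ∈ Y) (h₂ : p.R₂ ∈ Y) (h₀ : p.r₁ ∈ Y) :
    !![-1 / 4, 3 / 2, p.s / 2; 3 / 4, 1 / 2, p.s / 2; p.s / 8, p.s / 4, -5 / 4] ∈ Y.matrices := by
  have hs := p.s_sq
  have hσ := p.hσ
  have h2 := p.two_ne
  have h3 := p.three_ne
  have h5 := p.five_ne
  have h4 := p.four_ne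
  have h6 : (6 : F) ≠ 0 := by
    rw [show (6 : F) = 2 * 3 by norm_num]
    exact mul_ne_zero h2 h3
  have h8 : (8 : F) ≠ 0 := by
    rw [show (8 : F) = 2 * 4 by norm_num]
    exact mul_ne_zero h2 h4
  have h15 : (15 : F) ≠ 0 := by
    rw [show (15 : F) = 3 * 5 by norm_num]
    exact mul_ne_zero h3 h5
  have hN : (15 * 6 ^ 3 * 8 ^ 2 : F) ≠ 0 :=
    mul_ne_zero (mul_ne_zero h15 (pow_ne_zero 3 h6)) (pow_ne_zero 2 h8)
  obtain ⟨a, ha⟩ : ∃ a, 15 * a = 6 + 6 * p.σ + p.s * (2 * p.σ - 1) :=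
    ⟨(6 + 6 * p.σ + p.s * (2 * p.σ - 1)) / 15, by grind⟩
  obtain ⟨b, hb⟩ : ∃ b, 15 * b = p.s * (1 + p.σ) + 3 - 6 * p.σ :=
    ⟨(p.s * (1 + p.σ) + 3 - 6 * p.σ) / 15, by grind⟩
  have hab : a ^ 2 + 2 * b ^ 2 = 1 := by
    refine mul_left_cancel₀ (mul_ne_zero h15 h15) ?_
    grind
  have hab' : (-2 * p.σ / 3) ^ 2 + 2 * (p.σ / 6) ^ 2 = 1 := by grind
  have hk := mul_mem (p.rot_mem hF h₁ h₂ hab) (coe_mem_matrices.2 h₀)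
  have hk' := mul_mem hk (p.R₁_mul_rot_mem hF h₁ h₂ hab')
  refine mem_matrices_of_mul_mem hk ?_
  convert hk' using 1
  clear hk hk'
  clear hab hab'
  rw [r₁_coe, rot]
  ext i j
  fin_cases i <;> fin_cases j <;> simp [Matrix.mul_apply, Fin.sum_univ_three] <;>
    apply mul_left_cancel₀ hN <;> grind

end StringData
end generation

section elations

variable {F : Type*} [Field F] {Y : Subgroup (SL3 F)} {a b φ ψ : Fin 3 → F}

lemma elation_smul_mem (hN : ∀ x : F, ∃ n : ℕ, (n : F) = x) (h : φ ⬝ᵥ a = 0)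
    (ha : elation a φ ∈ Y.matrices) (k : F) : elation (k • a) φ ∈ Y.matrices := by
  obtain ⟨n, rfl⟩ := hN k
  induction n with
  | zero => simp [elation]
  | succ n ih =>
    rw [Nat.cast_succ, add_smul, one_smul, ← elation_mul_elation_left h]
    exact mul_mem ih ha

lemma elation_add_mem (h : φ ⬝ᵥ b = 0) (ha : elation a φ ∈ Y.matrices)
    (hb : elation b φ ∈ Y.matrices) : elation (a + b) φ ∈ Y.matrices :=
  elation_mul_elation_left (a := a) h ▸ mul_mem ha hb

lemma elation_add_mem_right (h : φ ⬝ᵥ a = 0) (ha : elation a φ ∈ Y.matrices)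
    (hb : elation a ψ ∈ Y.matrices) : elation a (φ + ψ) ∈ Y.matrices :=
  elation_mul_elation_right (ψ := ψ) h ▸ mul_mem ha hb

lemma elation_conj_mem (h : ψ ⬝ᵥ b = 0) (hb : elation b ψ ∈ Y.matrices)
    (ha : elation a φ ∈ Y.matrices) :
    elation (a + (ψ ⬝ᵥ a) • b) (φ - (φ ⬝ᵥ b) • ψ) ∈ Y.matrices :=
  elation_conj h a φ ▸ mul_mem (mul_mem hb ha)
    (mem_matrices_of_mul_eq_one hb (elation_mul_neg h))

/-- The elations `E₁₂`, `E₁₃`, `E₂₁` and `E₃₁` generate `SL₃(F)`. -/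
lemma eq_top_of_elation_mem_of_adjacent
    (h₁₂ : ∀ k, elation ![k, 0, 0] ![0, 1, 0] ∈ Y.matrices)
    (h₁₃ : ∀ k, elation ![k, 0, 0] ![0, 0, 1] ∈ Y.matrices)
    (h₂₁ : ∀ k, elation ![0, k, 0] ![1, 0, 0] ∈ Y.matrices)
    (h₃₁ : ∀ k, elation ![0, 0, k] ![1, 0, 0] ∈ Y.matrices) : Y = ⊤ := by
  have h₂₃ (k : F) : elation ![0, k, 0] ![0, 0, 1] ∈ Y.matrices := by
    have := elation_conj_mem (by simp) (h₂₁ k) (h₁₃ 1)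
    have := elation_add_mem (b := ![-1, 0, 0]) (by simp) (by simpa using this) (h₁₃ (-1))
    simpa using this
  have h₃₂ (k : F) : elation ![0, 0, k] ![0, 1, 0] ∈ Y.matrices := by
    have := elation_conj_mem (by simp) (h₃₁ k) (h₁₂ 1)
    have := elation_add_mem (b := ![-1, 0, 0]) (by simp) (by simpa using this) (h₁₂ (-1))
    simpa using this
  have hs (k : F) : Pi.single (0 : Fin 3) k = ![k, 0, 0] ∧ Pi.single (1 : Fin 3) k = ![0, k, 0] ∧
      Pi.single (2 : Fin 3) k = ![0, 0, k] := by
    refine ⟨?_, ?_, ?_⟩ <;> ext i <;> fin_cases i <;> simp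
  refine eq_top_of_forall_elation_mem fun i j hij k => ?_
  fin_cases i <;> fin_cases j <;> simp [(hs _).1, (hs _).2.1, (hs _).2.2, *] at hij ⊢

end elations

section generation

namespace StringData

variable {F : Type*} [Field F] {Y : Subgroup (SL3 F)} (p : StringData F)

lemma elation_mem (hF : HasCyclicTorus F) (hN : ∀ x : F, ∃ n : ℕ, (n : F) = x)
    (h₁ : p.R₁ ∈ Y) (h₂ : p.R₂ ∈ Y) (h₀ : p.r₁ ∈ Y) (h₄ : p.r₄ ∈ Y) (k : F) :
    elation ![6 * k, 6 * k, p.s * k] ![-5, 6, 2 * p.s] ∈ Y.matrices := by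
  have hs := p.s_sq
  have h8 : (8 : F) ≠ 0 := by
    rw [show (8 : F) = 2 * 4 by norm_num]
    exact mul_ne_zero p.two_ne p.four_ne
  have h := mul_mem (p.reflection₁_mem hF h₁ h₂ h₀) (p.reflection₄_mem hF h₁ h₂ h₄)
  have h' : elation ![6 / 8, 6 / 8, p.s / 8] ![-5, 6, 2 * p.s] ∈ Y.matrices := by
    convert h using 1
    ext i j
    fin_cases i <;> fin_cases j <;>
      simp [elation, Matrix.mul_apply, Fin.sum_univ_three] <;>
      apply mul_left_cancel₀ (mul_ne_zero h8 h8) <;> grind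
  have h0 : ![-5, 6, 2 * p.s] ⬝ᵥ ![6 / 8, 6 / 8, p.s / 8] = 0 := by
    simp [dotProduct, Fin.sum_univ_three]
    grind
  have := elation_smul_mem hN h0 h' (8 * k)
  convert this using 2
  ext i
  fin_cases i <;> simp <;> grind

/-- Conjugation by a diagonal involution. -/
lemma elation_diagonal_conj_mem {a b c x y z : F} {A : SL3 F} {u v w : F} (hA : A ∈ Y)
    (hA' : (A : Matrix (Fin 3) (Fin 3) F) = !![u, 0, 0; 0, v, 0; 0, 0, w])
    (hu : u * u = 1) (hv : v * v = 1) (hw : w * w = 1)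
    (h : elation ![a, b, c] ![x, y, z] ∈ Y.matrices) :
    elation ![u * a, v * b, w * c] ![x * u, y * v, z * w] ∈ Y.matrices := by
  have h1 := mul_mem (mul_mem (coe_mem_matrices.2 hA) h) (coe_mem_matrices.2 hA)
  rw [hA', mul_elation_mul] at h1
  · convert h1 using 2
    · ext i
      fin_cases i <;> simp [Matrix.mulVec, dotProduct, Fin.sum_univ_three]
    · ext i
      fin_cases i <;> simp [Matrix.vecMul, dotProduct, Fin.sum_univ_three]
  · ext i j
    fin_cases i <;> fin_cases j <;> simp [*]

lemma h_mem_of_mem (hF : HasCyclicTorus F) (h₁ : p.R₁ ∈ Y) (h₂ : p.R₂ ∈ Y) : p.h ∈ Y := by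
  rw [← coe_mem_matrices, h_coe]
  simpa [rot] using p.rot_mem hF h₁ h₂ (a := -1) (b := 0) (by simp)

lemma eq_top_of_mem (hF : HasCyclicTorus F) (hN : ∀ x : F, ∃ n : ℕ, (n : F) = x)
    (h₁ : p.R₁ ∈ Y) (h₂ : p.R₂ ∈ Y) (h₀ : p.r₁ ∈ Y) (h₄ : p.r₄ ∈ Y) : Y = ⊤ := by
  have hs := p.s_sq
  have h2 := p.two_ne
  have h3 := p.three_ne
  have hs0 : p.s ≠ 0 := by grind
  have h60 : (60 : F) ≠ 0 := by
    rw [show (60 : F) = 4 * 3 * 5 by norm_num]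
    exact mul_ne_zero (mul_ne_zero p.four_ne h3) p.five_ne
  have h48 : (48 : F) ≠ 0 := by
    rw [show (48 : F) = 4 * 4 * 3 by norm_num]
    exact mul_ne_zero (mul_ne_zero p.four_ne p.four_ne) h3
  obtain ⟨e, he⟩ : ∃ e : F, 60 * e = 1 := ⟨60⁻¹, mul_inv_cancel₀ h60⟩
  have hT := p.elation_mem hF hN h₁ h₂ h₀ h₄
  have hT' (k : F) := elation_diagonal_conj_mem (p.h_mem_of_mem hF h₁ h₂) p.h_coe (one_mul 1)
    (by simp) (by simp) (hT k)
  have hpsi (k : F) : ![-5, 6, 2 * p.s] ⬝ᵥ ![6 * k, 6 * k, p.s * k] = 0 := by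
    simp [dotProduct, Fin.sum_univ_three]
    grind
  obtain ⟨f, hf⟩ : ∃ f : F, 48 * f = 1 := ⟨48⁻¹, mul_inv_cancel₀ h48⟩
  have h1 (k : F) : elation ![k, 0, 0] ![0, 3, p.s] ∈ Y.matrices := by
    have := elation_conj_mem (hpsi (-e)) (hT (-e)) (hT' (-f * k))
    convert this using 1
    refine elation_congr fun i j => ?_
    clear this hT hT' hpsi
    fin_cases i <;> fin_cases j <;> simp [dotProduct, Fin.sum_univ_three] <;> grind
  have h1' (k : F) : elation ![0, 6 * k, p.s * k] ![1, 0, 0] ∈ Y.matrices := by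
    have := elation_conj_mem (hpsi e) (hT e) (hT' (3 * e * k))
    convert this using 1
    refine elation_congr fun i j => ?_
    clear this hT hT' hpsi h1
    fin_cases i <;> fin_cases j <;> simp [dotProduct, Fin.sum_univ_three] <;> grind
  have h2 (k : F) := elation_diagonal_conj_mem h₁ p.R₁_coe (by simp) (by simp) (by simp) (h1 k)
  have h2' (k : F) := elation_diagonal_conj_mem h₁ p.R₁_coe (by simp) (by simp) (by simp) (h1' k)
  clear hT hT' hpsi
  refine eq_top_of_elation_mem_of_adjacent (fun k => ?_) (fun k => ?_) (fun k => ?_) fun k => ?_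
  · have := elation_add_mem_right (by simp) (h1 (8 * f * k)) (by simpa using h2 (-(8 * f * k)))
    convert this using 1
    refine elation_congr fun i j => ?_
    clear this h1 h2 h1' h2'
    fin_cases i <;> fin_cases j <;> simp
    grind
  · obtain ⟨l, hl⟩ : ∃ l, 2 * p.s * l = k := ⟨k / (2 * p.s), by grind⟩
    have := elation_add_mem_right (ψ := -![0, 3, -p.s]) (by simp) (h1 l) (by
      convert h2 l using 1
      refine elation_congr fun i j => ?_
      fin_cases i <;> fin_cases j <;> simp)
    convert this using 1
    refine elation_congr fun i j => ?_
    clear this h1 h2 h1' h2'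
    fin_cases i <;> fin_cases j <;> simp
    grind
  · have := elation_add_mem (b := ![0, 6 * (4 * f * k), -(p.s * (4 * f * k))]) (by simp)
      (h1' (4 * f * k)) (by
        convert h2' (-(4 * f * k)) using 1
        refine elation_congr fun i j => ?_
        fin_cases i <;> fin_cases j <;> simp)
    convert this using 1
    refine elation_congr fun i j => ?_
    clear this h1 h2 h1' h2'
    fin_cases i <;> fin_cases j <;> simp
    grind
  · obtain ⟨l, hl⟩ : ∃ l, 2 * p.s * l = k := ⟨k / (2 * p.s), by grind⟩
    have := elation_add_mem (b := ![0, -(6 * l), p.s * l]) (by simp) (h1' l) (by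
      convert h2' l using 1
      refine elation_congr fun i j => ?_
      fin_cases i <;> fin_cases j <;> simp)
    convert this using 1
    refine elation_congr fun i j => ?_
    clear this h1 h2 h1' h2'
    fin_cases i <;> fin_cases j <;> simp
    grind

end StringData
end generation

section cstring

open Subgroup

namespace StringData

variable {F G : Type*} [Field F] [Group G] {ι : SL3 F →* G} {τ : G} (p : StringData F)

/-- The rank four string in `SL₃(F) ⋊ ⟨τ⟩`. -/
def gens (ι : SL3 F →* G) (τ : G) : Fin 4 → G :=
  ![ι p.S₀ * τ, ι p.R₁, ι p.R₂, ι p.S₃ * τ]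

lemma D_mem (hE : IsTransposeInverseExtension ι τ) (hF : HasCyclicTorus F) :
    ι p.D * τ ∈ closure {ι p.S₀ * τ, ι p.R₁, ι p.R₂} := by
  rw [S₀_map]
  exact (p.isStringEnd_left hE hF).c_mem

lemma D'_mem (hE : IsTransposeInverseExtension ι τ) (hF : HasCyclicTorus F) :
    ι p.D' * τ ∈ closure {ι p.R₁, ι p.R₂, ι p.S₃ * τ} := by
  rw [S₃_map]
  exact closure_mono (by grind) (p.isStringEnd_right hE hF).c_mem

lemma closure_gens (hE : IsTransposeInverseExtension ι τ) (hF : HasCyclicTorus F)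
    (hN : ∀ x : F, ∃ n : ℕ, (n : F) = x) : closure (Set.range (p.gens ι τ)) = ⊤ := by
  have hmem (i : Fin 4) : p.gens ι τ i ∈ closure (Set.range (p.gens ι τ)) :=
    subset_closure ⟨i, rfl⟩
  set X := closure (Set.range (p.gens ι τ))
  have h0 : ι p.S₀ * τ ∈ X := hmem 0
  have h1 : ι p.R₁ ∈ X := hmem 1
  have h2 : ι p.R₂ ∈ X := hmem 2
  have h3 : ι p.S₃ * τ ∈ X := hmem 3
  have hD : ι p.D * τ ∈ X := by
    refine (closure_le X).2 ?_ (p.D_mem hE hF)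
    rintro x (rfl | rfl | rfl) <;> assumption
  have hD' : ι p.D' * τ ∈ X := by
    refine (closure_le X).2 ?_ (p.D'_mem hE hF)
    rintro x (rfl | rfl | rfl) <;> assumption
  have htop : X.comap ι = ⊤ := by
    refine p.eq_top_of_mem hF hN h1 h2 ?_ ?_
    · rw [S₀_map] at h0
      exact (mul_mem_cancel_right hD).1 h0
    · rw [S₃_map] at h3
      exact (mul_mem_cancel_right hD').1 h3
  have hι (A : SL3 F) : ι A ∈ X := mem_comap.1 (htop ▸ mem_top A)
  have hτ : τ ∈ X := (mul_mem_cancel_left (hι _)).1 h0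
  refine eq_top_iff.2 fun g _ => ?_
  obtain ⟨A, rfl | rfl⟩ := hE.cover g
  exacts [hι A, mul_mem (hι A) hτ]

lemma R₁_ne_one : p.R₁ ≠ 1 := by
  intro h
  have h1 := congrArg (fun A : SL3 F => (A : Matrix (Fin 3) (Fin 3) F) 0 0) h
  have := p.two_ne
  simp [R₁_coe] at h1
  grind

lemma R₂_ne_one : p.R₂ ≠ 1 := by
  intro h
  have h1 := congrArg (fun A : SL3 F => (A : Matrix (Fin 3) (Fin 3) F) 0 0) h
  have := p.two_ne
  simp [R₂_coe] at h1
  grind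

lemma isCString (hE : IsTransposeInverseExtension ι τ) (hF : HasCyclicTorus F)
    (hN : ∀ x : F, ∃ n : ℕ, (n : F) = x) : IsCString (p.gens ι τ) := by
  have hS := p.isString hE hF
  have hout (A : SL3 F) : ι A * τ ≠ 1 := by
    rw [← map_one ι]
    exact (hE.inner_ne_outer _ _).symm
  refine ⟨fun i => ?_, p.closure_gens hE hF hN, fun i j hij => ?_, hS.inf_closure_image
    (p.closure_gens hE hF hN)⟩
  · refine orderOf_eq_prime ?_ ?_
    · rw [pow_two]
      fin_cases i
      exacts [hS.a_mul, hS.b_mul, hS.c_mul, hS.d_mul]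
    · fin_cases i
      · exact hout _
      · exact (map_ne_one_iff ι hE.injective).2 p.R₁_ne_one
      · exact (map_ne_one_iff ι hE.injective).2 p.R₂_ne_one
      · exact hout _
  · fin_cases i <;> fin_cases j <;> simp at hij
    exacts [hS.ac, hS.ad, hS.bd, hS.ac.symm, hS.ad.symm, hS.bd.symm]

lemma orderOf_gens_zero_mul (hE : IsTransposeInverseExtension ι τ) (hF : HasCyclicTorus F) :
    orderOf (p.gens ι τ 0 * p.gens ι τ 1) = 4 := by
  change orderOf (ι p.S₀ * τ * ι p.R₁) = 4
  rw [S₀_map]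
  exact (p.isStringEnd_left hE hF).orderOf_mul

lemma orderOf_gens_two_mul (hE : IsTransposeInverseExtension ι τ) (hF : HasCyclicTorus F) :
    orderOf (p.gens ι τ 2 * p.gens ι τ 3) = 4 := by
  change orderOf (ι p.R₂ * (ι p.S₃ * τ)) = 4
  have hR := p.isStringEnd_right hE hF
  rw [← orderOf_inv, _root_.mul_inv_rev, inv_eq_of_mul_eq_one_left hR.a_mul, S₃_map,
    inv_eq_of_mul_eq_one_left hR.mul_self]
  exact hR.orderOf_mul

lemma exists_scalar_of_mem_center {A : SL3 F} (hA : A ∈ center (SL3 F)) :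
    ∃ r : F, r ^ 3 = 1 ∧ (A : Matrix (Fin 3) (Fin 3) F) = r • 1 := by
  obtain ⟨r, hr, hrA⟩ := Matrix.SpecialLinearGroup.mem_center_iff.1 hA
  refine ⟨r, by simpa using hr, ?_⟩
  rw [← hrA, Matrix.smul_one_eq_diagonal]
  rfl

/-- No symmetric or alternating form is preserved up to scalars by all of `SL₃(F)`. -/
lemma exists_notMem_center (p : StringData F) (A : SL3 F) :
    ∃ B : SL3 F, B * A * B.transpose * A⁻¹ ∉ center (SL3 F) := by
  by_contra! hc
  have h2 := p.two_ne
  have key (B : SL3 F) : ∃ r : F, r ^ 3 = 1 ∧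
      (B : Matrix (Fin 3) (Fin 3) F) * A * (B : Matrix (Fin 3) (Fin 3) F)ᵀ =
        r • (A : Matrix (Fin 3) (Fin 3) F) := by
    obtain ⟨r, hr, hrB⟩ := exists_scalar_of_mem_center (hc B)
    refine ⟨r, hr, ?_⟩
    have : B * A * B.transpose = B * A * B.transpose * A⁻¹ * A := by group
    have := congrArg (fun A : SL3 F => (A : Matrix (Fin 3) (Fin 3) F)) this
    simp only [Matrix.SpecialLinearGroup.coe_mul, Matrix.SpecialLinearGroup.coe_transpose]
      at this hrB
    rw [this, hrB, smul_one_mul]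
  obtain ⟨r, hr, hh⟩ := key p.h
  obtain ⟨r', hr', hR⟩ := key p.R₁
  obtain ⟨r'', -, hT⟩ := key ⟨!![1, 1, 0; 0, 1, 0; 0, 0, 1], by simp [det_fin_three]⟩
  clear key hc
  have hT' := congr_fun₂ hT 0 1
  rw [h_coe] at hh
  rw [R₁_coe] at hR
  have h' (i j : Fin 3) := congr_fun₂ hh i j
  have h'' (i j : Fin 3) := congr_fun₂ hR i j
  have e1 := h' 0 1
  have e2 := h' 0 2
  have e3 := h' 1 0
  have e4 := h' 2 0
  have f1 := h'' 1 0
  have f2 := h'' 1 2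
  have f3 := h'' 0 1
  have f4 := h'' 2 1
  have hdet := A.2
  rw [det_fin_three] at hdet
  simp [Matrix.mul_apply, Matrix.vecMul, dotProduct, Fin.sum_univ_three] at *
  have hr1 : r ≠ -1 := by rintro rfl; grind
  have hr1' : r' ≠ -1 := by rintro rfl; grind
  clear hh hR hT h' h''
  grind

lemma le_range_of_comap_le_center (p : StringData F) (hE : IsTransposeInverseExtension ι τ)
    {N : Subgroup G}
    [hn : N.Normal] (hN : N.comap ι ≤ center (SL3 F)) : N ≤ ι.range := by
  intro g hg
  obtain ⟨A, rfl | rfl⟩ := hE.cover g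
  · exact ⟨A, rfl⟩
  obtain ⟨B, hB⟩ := p.exists_notMem_center A
  refine absurd (hN (mem_comap.2 ?_)) hB
  have h1 : ι (B * A * B.transpose) * τ ∈ N := by
    have := hn.conj_mem _ hg (ι B)
    rwa [← map_inv, ← mul_assoc (ι B), ← map_mul, hE.outer_mul_inner,
      IsTransposeInverseExtension.inv_transpose, inv_inv] at this
  have h2 := mul_mem h1 (inv_mem hg)
  rwa [_root_.mul_inv_rev, mul_assoc, mul_inv_cancel_left, ← map_inv, ← map_mul] at h2

lemma z_mem_of_comap_le_center (hE : IsTransposeInverseExtension ι τ) {N : Subgroup G}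
    [N.Normal] (hN : N.comap ι ≤ center (SL3 F)) (hbot : N ≠ ⊥) : ι p.z ∈ N := by
  obtain ⟨g, hg, hg1⟩ := N.bot_or_exists_ne_one.resolve_left hbot
  obtain ⟨A, rfl⟩ := p.le_range_of_comap_le_center hE hN hg
  obtain ⟨r, hr, hA⟩ := exists_scalar_of_mem_center (hN (mem_comap.2 hg))
  have hr1 : r ≠ 1 := by
    rintro rfl
    refine hg1 ?_
    rw [show A = 1 from eq_of_coe_eq (by simp [hA]), map_one]
  have hz : (p.z : Matrix (Fin 3) (Fin 3) F) = p.ω • 1 := by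
    rw [z_coe]
    ext i j
    fin_cases i <;> fin_cases j <;> simp
  have hrω : r = p.ω ∨ r ^ 2 = p.ω := by
    have := p.hω
    grind
  rcases hrω with h | h
  · rwa [show p.z = A from eq_of_coe_eq (by rw [hz, hA, h])]
  · rw [show p.z = A ^ 2 from eq_of_coe_eq (by
      rw [Matrix.SpecialLinearGroup.coe_pow, hz, hA, smul_pow, one_pow, h]), map_pow]
    exact pow_mem hg 2

lemma D'_map_mul_h (hE : IsTransposeInverseExtension ι τ) :
    ι p.D' * τ * ι p.h = ι p.z * (ι p.D * τ) := by
  have hD' : p.D' = p.z * p.D * p.h.transpose := by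
    refine eq_of_coe_eq ?_
    simp only [Matrix.SpecialLinearGroup.coe_mul, Matrix.SpecialLinearGroup.coe_transpose, D_coe,
      D'_coe, z_coe, h_coe]
    ext i j
    fin_cases i <;> fin_cases j <;> simp [Matrix.mul_apply, Fin.sum_univ_three, div_eq_mul_inv,
      mul_comm]
  rw [hE.outer_mul_inner_eq hD', map_mul, mul_assoc]

lemma isUnravelled (hE : IsTransposeInverseExtension ι τ) (hF : HasCyclicTorus F) :
    IsUnravelled (p.gens ι τ) := by
  intro N _ hbot htop
  by_cases hN : N.comap ι ≤ center (SL3 F)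
  · refine Or.inr fun hC => ?_
    have hz := p.z_mem_of_comap_le_center hE hN hbot
    have himage (J : Set (Fin 4)) :
        closure ((fun i => (QuotientGroup.mk (p.gens ι τ i) : G ⧸ N)) '' J) =
          (closure (p.gens ι τ '' J)).map (QuotientGroup.mk' N) := by
      rw [MonoidHom.map_closure, Set.image_image]
      rfl
    have hcap := hC.2.2.2 {0, 1, 2} {1, 2, 3}
    rw [himage, himage, himage] at hcap
    have hI : ({0, 1, 2} : Set (Fin 4)) ∩ {1, 2, 3} = {1, 2} := by
      ext i
      fin_cases i <;> simp
    rw [hI] at hcap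
    simp only [Set.image_insert_eq, Set.image_singleton] at hcap
    have h1 : (QuotientGroup.mk' N) (ι p.D * τ) ∈
        (closure {p.gens ι τ 1, p.gens ι τ 2}).map (QuotientGroup.mk' N) := by
      rw [← hcap]
      refine ⟨mem_map_of_mem _ (p.D_mem hE hF), ?_⟩
      have hh : ι p.D' * τ * ι p.h ∈ closure {ι p.R₁, ι p.R₂, ι p.S₃ * τ} :=
        mul_mem (p.D'_mem hE hF) (closure_mono (by grind) (map_mem_closure (p.h_mem hF)))
      refine ⟨_, hh, ?_⟩
      rw [D'_map_mul_h p hE, map_mul, QuotientGroup.mk'_apply N (ι p.z),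
        (QuotientGroup.eq_one_iff _).2 hz, one_mul]
    obtain ⟨g, hg, hgc⟩ := h1
    have hg' : g ∈ ι.range := (p.isStringEnd_left hE hF).closure_le_inner hg
    rw [QuotientGroup.mk'_apply, QuotientGroup.mk'_apply, QuotientGroup.eq] at hgc
    have h2 := p.le_range_of_comap_le_center hE hN hgc
    exact (p.isStringEnd_left hE hF).c_notMem ((mul_mem_cancel_left (inv_mem hg')).1 h2)
  · refine Or.inl fun hinj => ?_
    obtain ⟨A, hA, hAc⟩ := SetLike.not_le_iff_exists.1 hN
    have hY := eq_top_of_notMem_center hA hAc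
    have hmem (A : SL3 F) : ι A ∈ N := mem_comap.1 (hY ▸ mem_top A)
    have : (1 : Fin 4) = 2 := hinj
      (((QuotientGroup.eq_one_iff _).2 (hmem p.R₁)).trans
        ((QuotientGroup.eq_one_iff _).2 (hmem p.R₂)).symm)
    exact absurd this (by decide)

end StringData
end cstring

section fields

namespace StringData

variable {F K : Type*} [Field F] [Field K] [Algebra F K]

lemma rot_pow_eq {α η : K} (hη : η ^ 2 = -2) {u v : F}
    (hα : α = algebraMap F K u + algebraMap F K v * η) (k : ℕ) :
    ∃ a b : F, rot u v ^ k = rot a b ∧ α ^ k = algebraMap F K a + algebraMap F K b * η := by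
  induction k with
  | zero => exact ⟨1, 0, by rw [pow_zero, rot_one_zero], by simp⟩
  | succ k ih =>
    obtain ⟨a, b, h1, h2⟩ := ih
    refine ⟨_, _, by rw [pow_succ, h1, rot_mul_rot], ?_⟩
    rw [pow_succ, h2, hα]
    simp only [map_sub, map_add, map_mul, map_ofNat]
    linear_combination (algebraMap F K b) * (algebraMap F K v) * hη

lemma eq_and_eq_of_add_mul_eq {η : K} (hη : ∀ e, algebraMap F K e ≠ η) {a b a' b' : F}
    (h : algebraMap F K a + algebraMap F K b * η = algebraMap F K a' + algebraMap F K b' * η) :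
    a = a' ∧ b = b' := by
  have hb : b = b' := by
    by_contra hb
    have hb' : algebraMap F K (b - b') ≠ 0 :=
      (map_ne_zero _).2 (sub_ne_zero.2 hb)
    refine hη ((a' - a) / (b - b')) ?_
    rw [map_div₀, div_eq_iff hb', map_sub, map_sub]
    linear_combination -h
  subst hb
  exact ⟨(algebraMap F K).injective (add_right_cancel h), rfl⟩

variable [Fintype F]

/-- An element whose order is larger than the size of the field generating it over the prime field
by a self-reciprocal equation forces that field to be prime. -/
lemma exists_natCast_eq {α : K} (hα : 3 * α ^ 2 + 2 * α + 3 = 0) (h3 : (3 : K) ≠ 0)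
    (hord : orderOf α = Fintype.card F + 1) (x : F) : ∃ n : ℕ, (n : F) = x := by
  obtain ⟨p, hp⟩ := CharP.exists F
  obtain ⟨n, hpp, hcard⟩ := FiniteField.card F p
  have : CharP K p := charP_of_injective_algebraMap (algebraMap F K).injective p
  have : Fact p.Prime := ⟨hpp⟩
  have hα0 : α ≠ 0 := by
    rintro rfl
    exact h3 (by simpa using hα)
  have hfrob : 3 * (α ^ p) ^ 2 + 2 * α ^ p + 3 = 0 := by
    have := congrArg (frobenius K p) hα
    rw [map_add, map_add, map_mul, map_mul, map_pow, map_ofNat, map_ofNat, map_zero] at this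
    exact this
  have hmul : (α ^ p - α) * (α ^ p * α - 1) = 0 := by
    refine mul_left_cancel₀ h3 ?_
    linear_combination α * hfrob - α ^ p * hα
  have hle : p ≤ Fintype.card F := hcard ▸ Nat.le_self_pow n.2.ne' p
  have hcardp : Fintype.card F = p := by
    rcases mul_eq_zero.1 hmul with h | h
    · have h1 : α ^ (p - 1) = 1 := by
        refine mul_right_cancel₀ hα0 ?_
        rw [← pow_succ, Nat.sub_add_cancel hpp.one_le, one_mul, sub_eq_zero.1 h]
      have := Nat.le_of_dvd (Nat.sub_pos_of_lt hpp.one_lt) (orderOf_dvd_of_pow_eq_one h1)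
      omega
    · have h1 : α ^ (p + 1) = 1 := by rw [pow_succ, sub_eq_zero.1 h]
      have := Nat.le_of_dvd p.succ_pos (orderOf_dvd_of_pow_eq_one h1)
      omega
  obtain ⟨y, rfl⟩ := (ZMod.castHom_bijective F hcardp).2 x
  have : NeZero p := ⟨hpp.ne_zero⟩
  exact ⟨y.val, by rw [ZMod.castHom_apply, ZMod.natCast_val]⟩

/-- The field facts making the torus cyclic. -/
lemma exists_stringData (h6 : 6 ∣ Fintype.card F - 1) (hσ : ∃ σ : F, σ ^ 2 = 2) {θ : K}
    (hθ : θ ^ 2 = algebraMap F K ((3 : F)⁻¹ ^ 2 - 1))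
    (hord : orderOf (-(algebraMap F K (3 : F)⁻¹) + θ) = Fintype.card F + 1) :
    Nonempty (StringData F) ∧ HasCyclicTorus F ∧ (∀ x : F, ∃ n : ℕ, (n : F) = x) ∧
      orderOf (rot (-1 / 3 : F) (-2 / 3)) = Fintype.card F + 1 := by
  obtain ⟨m, hm⟩ := h6
  have hcard1 : 1 < Fintype.card F := Fintype.one_lt_card
  have hcard : Fintype.card F = 2 * 3 * m + 1 := by omega
  have hcast : (2 * 3 * m + 1 : F) = 0 := by
    have := FiniteField.cast_card_eq_zero F
    rw [hcard] at this
    exact_mod_cast this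
  have h2 : (2 : F) ≠ 0 := fun h => by simp [h] at hcast
  have h3 : (3 : F) ≠ 0 := fun h => by simp [h] at hcast
  obtain ⟨σ, hσ⟩ := hσ
  set α := -(algebraMap F K (3 : F)⁻¹) + θ with hα
  have h2K : (2 : K) ≠ 0 := by
    rw [← map_ofNat (algebraMap F K) 2]
    exact (map_ne_zero _).2 h2
  have h3K : (3 : K) ≠ 0 := by
    rw [← map_ofNat (algebraMap F K) 3]
    exact (map_ne_zero _).2 h3
  have hinv : algebraMap F K (3 : F)⁻¹ = 3⁻¹ := by rw [map_inv₀, map_ofNat]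
  obtain ⟨η, hη⟩ : ∃ η, η = -(3 / 2) * θ := ⟨_, rfl⟩
  rw [map_sub, map_pow, hinv, map_one] at hθ
  rw [hinv] at hα
  have hη2 : η ^ 2 = -2 := by
    have h4 : (4 : K) ≠ 0 := by
      rw [show (4 : K) = 2 * 2 by norm_num]
      exact mul_ne_zero h2K h2K
    rw [hη, mul_pow, hθ]
    field_simp
    ring
  have hαη : α = algebraMap F K (-1 / 3) + algebraMap F K (-2 / 3) * η := by
    rw [hα, hη]
    simp only [map_div₀, map_neg, map_one, map_ofNat]
    field_simp
  have hα3 : 3 * α ^ 2 + 2 * α + 3 = 0 := by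
    rw [hα]
    have : θ ^ 2 * 9 = -8 := by
      rw [hθ]
      field_simp
      ring
    field_simp
    linear_combination this
  have hα0 : α ≠ 0 := by
    rintro h
    rw [h] at hα3
    exact h3K (by simpa using hα3)
  have hαq : α ^ Fintype.card F ≠ α := fun h => by
    have h1 : α ^ (Fintype.card F - 1) = 1 := by
      refine mul_right_cancel₀ hα0 ?_
      rw [← pow_succ, Nat.sub_add_cancel hcard1.le, one_mul, h]
    have := Nat.le_of_dvd (by omega) (orderOf_dvd_of_pow_eq_one h1)
    omega
  have hfrob (a b : F) : (algebraMap F K a + algebraMap F K b * η) ^ Fintype.card F =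
      algebraMap F K a + algebraMap F K b * η ^ Fintype.card F := by
    have := map_add (FiniteField.frobeniusAlgHom F K) (algebraMap F K a) (algebraMap F K b * η)
    rw [map_mul, AlgHom.commutes, AlgHom.commutes] at this
    exact this
  have hηq : η ^ Fintype.card F = -η := by
    have h1 : (η ^ Fintype.card F) ^ 2 = η ^ 2 := by
      rw [← pow_mul, mul_comm, pow_mul, hη2,
        show (-2 : K) = algebraMap F K (-2) by rw [map_neg, map_ofNat], ← map_pow,
        FiniteField.pow_card]
    rcases sq_eq_sq_iff_eq_or_eq_neg.1 h1 with h | h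
    · refine absurd ?_ hαq
      rw [hαη, hfrob, h]
    · exact h
  have hη0 (e : F) : algebraMap F K e ≠ η := by
    rintro rfl
    rw [← map_pow, FiniteField.pow_card] at hηq
    have : (2 : K) * algebraMap F K e = 0 := by linear_combination hηq
    rcases mul_eq_zero.1 this with h | h
    · exact h2K h
    · rw [h] at hη2
      exact h2K (by linear_combination hη2)
  have h5 : (5 : F) ≠ 0 := fun h => by
    have h1 : (algebraMap F K (2 * σ)) ^ 2 = η ^ 2 := by
      rw [hη2, ← map_pow, show (2 * σ) ^ 2 = -2 by linear_combination 4 * hσ + 2 * h,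
        map_neg, map_ofNat]
    rcases sq_eq_sq_iff_eq_or_eq_neg.1 h1 with h | h
    · exact hη0 _ h
    · exact hη0 (-(2 * σ)) (by rw [map_neg, h, neg_neg])
  refine ⟨?_, fun a b hab => ?_, exists_natCast_eq hα3 h3K hord, ?_⟩
  · classical
    have : Fact (Nat.Prime 3) := ⟨Nat.prime_three⟩
    obtain ⟨x, hx⟩ := exists_prime_orderOf_dvd_card (G := Fˣ) 3 (by
      rw [Fintype.card_units, hcard]
      exact ⟨2 * m, by rw [Nat.add_sub_cancel]; ring⟩)
    have hx3 : (x : F) ^ 3 = 1 := by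
      rw [← Units.val_pow_eq_pow_val, ← hx, pow_orderOf_eq_one, Units.val_one]
    have hx1 : (x : F) - 1 ≠ 0 := fun h => by
      have h1 : x = 1 := Units.ext (sub_eq_zero.1 h)
      rw [h1, orderOf_one] at hx
      omega
    refine ⟨⟨x, σ, h2, h3, h5, mul_left_cancel₀ hx1 ?_, hσ⟩⟩
    linear_combination hx3
  · have hprim : IsPrimitiveRoot α (Fintype.card F + 1) := hord ▸ IsPrimitiveRoot.orderOf α
    obtain ⟨k, -, hk⟩ := hprim.eq_pow_of_pow_eq_one
      (ξ := algebraMap F K a + algebraMap F K b * η) (by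
        rw [pow_succ, hfrob, hηq]
        have := congrArg (algebraMap F K) hab
        simp only [map_add, map_mul, map_pow, map_ofNat, map_one] at this
        linear_combination this - (algebraMap F K b) ^ 2 * hη2)
    obtain ⟨a', b', h1, h2⟩ := rot_pow_eq hη2 hαη k
    obtain ⟨rfl, rfl⟩ := eq_and_eq_of_add_mul_eq hη0 (hk.symm.trans h2)
    exact ⟨k, h1.symm⟩
  · rw [← hord, orderOf_eq_orderOf_iff]
    intro k
    obtain ⟨a, b, h1, h2⟩ := rot_pow_eq hη2 hαη k
    rw [h1, h2, ← rot_one_zero]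
    constructor
    · intro h
      obtain ⟨rfl, rfl⟩ := rot_injective h
      simp
    · intro h
      obtain ⟨rfl, rfl⟩ := eq_and_eq_of_add_mul_eq (a' := 1) (b' := 0) hη0 (by simpa using h)
      rfl

end StringData
end fields

section embedding

variable {F : Type*} [Field F]

/-- The block-diagonal embedding `A ↦ diag(A, A⁻ᵀ)` of `SL₃(F)` in `GL₆(F)`. -/
def blockEmbedding : SL3 F →* GL (Fin 3 ⊕ Fin 3) F :=
  MonoidHom.toHomUnits
    { toFun := fun A => fromBlocks (A : Matrix (Fin 3) (Fin 3) F) 0 0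
        (A⁻¹.transpose : SL3 F)
      map_one' := by
        rw [inv_one, Matrix.SpecialLinearGroup.coe_transpose, Matrix.SpecialLinearGroup.coe_one,
          transpose_one, fromBlocks_one]
      map_mul' := fun A B => by
        rw [fromBlocks_multiply, _root_.mul_inv_rev]
        simp only [Matrix.SpecialLinearGroup.coe_transpose, Matrix.SpecialLinearGroup.coe_mul,
          transpose_mul, Matrix.mul_zero, Matrix.zero_mul, add_zero, zero_add] }

lemma blockEmbedding_coe (A : SL3 F) :
    (blockEmbedding A : Matrix (Fin 3 ⊕ Fin 3) (Fin 3 ⊕ Fin 3) F) =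
      fromBlocks (A : Matrix (Fin 3) (Fin 3) F) 0 0 (A⁻¹.transpose : SL3 F) :=
  rfl

lemma coe_inv_transpose (A : SL3 F) :
    ((A⁻¹.transpose : SL3 F) : Matrix (Fin 3) (Fin 3) F) = ((A : Matrix (Fin 3) (Fin 3) F)ᵀ)⁻¹ := by
  symm
  apply Matrix.inv_eq_left_inv
  rw [← Matrix.SpecialLinearGroup.coe_transpose, ← Matrix.SpecialLinearGroup.coe_mul,
    IsTransposeInverseExtension.inv_transpose_mul_transpose, Matrix.SpecialLinearGroup.coe_one]

lemma blockEmbedding_injective :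
    Function.Injective (blockEmbedding : SL3 F → GL (Fin 3 ⊕ Fin 3) F) := by
  intro A B h
  have := congrArg Units.val h
  rw [blockEmbedding_coe, blockEmbedding_coe, fromBlocks_inj] at this
  exact Subtype.ext this.1

lemma exists_isTransposeInverseExtension {tu : GL (Fin 3 ⊕ Fin 3) F}
    (htu : (tu : Matrix (Fin 3 ⊕ Fin 3) (Fin 3 ⊕ Fin 3) F) = fromBlocks 0 1 1 0)
    {G : Subgroup (GL (Fin 3 ⊕ Fin 3) F)}
    (hG : G = Subgroup.closure
      ({g : GL (Fin 3 ⊕ Fin 3) F | ∃ A : Matrix (Fin 3) (Fin 3) F,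
          A.det = 1 ∧ (g : Matrix (Fin 3 ⊕ Fin 3) (Fin 3 ⊕ Fin 3) F) =
            fromBlocks A 0 0 (Aᵀ)⁻¹} ∪ {tu})) :
    ∃ (ι : SL3 F →* G) (τ : G), IsTransposeInverseExtension ι τ := by
  have hset : {g : GL (Fin 3 ⊕ Fin 3) F | ∃ A : Matrix (Fin 3) (Fin 3) F,
      A.det = 1 ∧ (g : Matrix (Fin 3 ⊕ Fin 3) (Fin 3 ⊕ Fin 3) F) = fromBlocks A 0 0 (Aᵀ)⁻¹} =
      Set.range blockEmbedding := by
    ext g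
    constructor
    · rintro ⟨A, hA, hg⟩
      obtain ⟨B, rfl⟩ : ∃ B : SL3 F, (B : Matrix (Fin 3) (Fin 3) F) = A := ⟨⟨A, hA⟩, rfl⟩
      exact ⟨B, Units.ext (by rw [blockEmbedding_coe, coe_inv_transpose, hg])⟩
    · rintro ⟨A, rfl⟩
      exact ⟨A, A.2, by rw [blockEmbedding_coe, coe_inv_transpose]⟩
  rw [hset] at hG
  have hmem (A : SL3 F) : blockEmbedding A ∈ G :=
    hG ▸ Subgroup.subset_closure (Or.inl ⟨A, rfl⟩)
  have htmem : tu ∈ G := hG ▸ Subgroup.subset_closure (Or.inr rfl)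
  have htt : tu * tu = 1 := by
    apply Units.ext
    rw [Units.val_mul, htu, fromBlocks_multiply]
    simp
  have hconj (A : SL3 F) : tu * blockEmbedding A = blockEmbedding A⁻¹.transpose * tu := by
    apply Units.ext
    rw [Units.val_mul, Units.val_mul, htu, blockEmbedding_coe, blockEmbedding_coe,
      fromBlocks_multiply, fromBlocks_multiply]
    have h : (A⁻¹.transpose⁻¹.transpose : SL3 F) = A := by
      have h1 := IsTransposeInverseExtension.inv_transpose_mul_transpose A
      rw [inv_eq_of_mul_eq_one_right h1]
      exact Subtype.ext (transpose_transpose _)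
    rw [h]
    simp
  have hinv : tu⁻¹ = tu := inv_eq_of_mul_eq_one_right htt
  refine ⟨blockEmbedding.codRestrict G hmem, ⟨tu, htmem⟩,
    fun A B h => blockEmbedding_injective (congrArg Subtype.val h), Subtype.ext htt,
    fun A => Subtype.ext (hconj A), fun ⟨g, hg⟩ => ?_, fun A h => ?_⟩
  · suffices ∃ A, g = blockEmbedding A ∨ g = blockEmbedding A * tu by
      obtain ⟨A, h⟩ := this
      exact ⟨A, h.imp Subtype.ext Subtype.ext⟩
    rw [hG] at hg
    induction hg using Subgroup.closure_induction with
    | mem x hx =>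
      rcases hx with ⟨A, rfl⟩ | rfl
      · exact ⟨A, Or.inl rfl⟩
      · exact ⟨1, Or.inr (by rw [map_one, one_mul])⟩
    | one => exact ⟨1, Or.inl (map_one _).symm⟩
    | mul x y _ _ hx hy =>
      obtain ⟨A, rfl | rfl⟩ := hx <;> obtain ⟨B, rfl | rfl⟩ := hy
      · exact ⟨A * B, Or.inl (map_mul _ _ _).symm⟩
      · exact ⟨A * B, Or.inr (by rw [map_mul, mul_assoc])⟩
      · exact ⟨A * B⁻¹.transpose, Or.inr (by rw [map_mul, mul_assoc, hconj, mul_assoc])⟩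
      · exact ⟨A * B⁻¹.transpose, Or.inl (by
          rw [map_mul, mul_assoc, ← mul_assoc tu, hconj, mul_assoc, htt, mul_one])⟩
    | inv x _ hx =>
      obtain ⟨A, rfl | rfl⟩ := hx
      · exact ⟨A⁻¹, Or.inl (map_inv _ _).symm⟩
      · exact ⟨A⁻¹⁻¹.transpose, Or.inr (by
          rw [_root_.mul_inv_rev, hinv, ← map_inv, hconj])⟩
  · have := congrArg Units.val (congrArg Subtype.val h)
    rw [htu] at this
    exact zero_ne_one (fromBlocks_inj.1 this).2.1

lemma StringData.orderOf_gens_one_mul {G : Type*} [Group G] {ι : SL3 F →* G} {τ : G}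
    (p : StringData F) (hE : IsTransposeInverseExtension ι τ) :
    orderOf (p.gens ι τ 1 * p.gens ι τ 2) = orderOf (rot (-1 / 3 : F) (-2 / 3)) := by
  change orderOf (ι p.R₁ * ι p.R₂) = _
  rw [← map_mul, orderOf_injective ι hE.injective, ← p.R₁_mul_R₂_coe]
  exact (orderOf_injective (Matrix.SpecialLinearGroup.coeMonoidHom (ι := Fin 3) (R := F))
    Matrix.SpecialLinearGroup.coeMonoidHom_injective (p.R₁ * p.R₂)).symm

end embedding

theorem stmt_0 (q : ℕ) (hq : IsPrimePow q)
    (F : Type) [Field F] [Fintype F] (hF : Fintype.card F = q)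
    (K : Type) [Field K] [Fintype K] [Algebra F K] (hK : Fintype.card K = q ^ 2)
    (h6 : 6 ∣ q - 1)
    (hii : ∃ lam mu : F, 2 * lam ^ 2 = 1 ∧ 2 * mu ^ 2 - lam ^ 2 = 0)
    (hiii : ∃ theta : K, theta ^ 2 = algebraMap F K ((3 : F)⁻¹ ^ 2 - 1) ∧
      (orderOf (-(algebraMap F K (3 : F)⁻¹) + theta) = q + 1 ∨
       orderOf (-(algebraMap F K (3 : F)⁻¹) - theta) = q + 1))
    (tu : GL (Fin 3 ⊕ Fin 3) F)
    (htu : (tu : Matrix (Fin 3 ⊕ Fin 3) (Fin 3 ⊕ Fin 3) F) = fromBlocks 0 1 1 0)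
    (G : Subgroup (GL (Fin 3 ⊕ Fin 3) F))
    (hG : G = Subgroup.closure
      ({g : GL (Fin 3 ⊕ Fin 3) F | ∃ A : Matrix (Fin 3) (Fin 3) F,
          A.det = 1 ∧ (g : Matrix (Fin 3 ⊕ Fin 3) (Fin 3 ⊕ Fin 3) F) =
            fromBlocks A 0 0 (Aᵀ)⁻¹} ∪ {tu})) :
    ∃ ts : Fin 4 → ↥G, IsCString ts ∧ IsUnravelled ts ∧
      orderOf (ts 0 * ts 1) = 4 ∧ orderOf (ts 1 * ts 2) = q + 1 ∧ orderOf (ts 2 * ts 3) = 4 := by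
  subst hF
  obtain ⟨ι, τ, hE⟩ := exists_isTransposeInverseExtension htu hG
  obtain ⟨lam, -, hlam, -⟩ := hii
  have hσ : ∃ σ : F, σ ^ 2 = 2 := ⟨2 * lam, by linear_combination 2 * hlam⟩
  obtain ⟨θ, hθ, hord⟩ : ∃ θ : K, θ ^ 2 = algebraMap F K ((3 : F)⁻¹ ^ 2 - 1) ∧
      orderOf (-(algebraMap F K (3 : F)⁻¹) + θ) = Fintype.card F + 1 := by
    obtain ⟨θ, hθ, h | h⟩ := hiii
    · exact ⟨θ, hθ, h⟩
    · exact ⟨-θ, by rw [neg_sq, hθ], by rw [← sub_eq_add_neg, h]⟩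
  obtain ⟨⟨p⟩, hT, hN, hrot⟩ := StringData.exists_stringData h6 hσ hθ hord
  exact ⟨p.gens ι τ, p.isCString hE hT hN, p.isUnravelled hE hT, p.orderOf_gens_zero_mul hE hT,
    by rw [p.orderOf_gens_one_mul hE, hrot], p.orderOf_gens_two_mul hE hT⟩
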